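/- Let V = V_1 ⊕ V_2 ⊕ V_4 and R = O(V)^{SL(2,ℂ)}. Then R has a homogeneous system of parameters consisting of seven invariants, of degrees 2, 2, 3, 3, 4, 5, 6, and the minimal number of algebra generators of R equals 18 (with 2 generators of degree 2, 3 of degree 3, 2 of degree 4, 3 of degree 5, 4 of degree 6, 2 of degree 7, 1 of degree 8, and 1 of degree 9). -/

import Mathlib

open MvPolynomial

noncomputable section

namespace BinInv

/-- `k`-fold partial derivative with respect to the variable `v`. -/
def pd {A : Type*} [CommSemiring A] (v : Fin 2) (k : ℕ)
    (f : MvPolynomial (Fin 2) A) : MvPolynomial (Fin 2) A :=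
  (fun g => MvPolynomial.pderiv v g)^[k] f

/-- The `p`-th transvectant of binary forms `g`, `h` of degrees `m`, `n`,
with coefficients in a commutative `ℂ`-algebra `A`. -/
def transvectant {A : Type*} [CommRing A] [Algebra ℂ A] (m n p : ℕ)
    (g h : MvPolynomial (Fin 2) A) : MvPolynomial (Fin 2) A :=
  algebraMap ℂ (MvPolynomial (Fin 2) A)
      ((((m - p).factorial * (n - p).factorial : ℕ) : ℂ) /
        (((m.factorial * n.factorial : ℕ)) : ℂ)) *
    ∑ i ∈ Finset.range (p + 1),
      algebraMap ℂ (MvPolynomial (Fin 2) A) ((-1 : ℂ) ^ i * (p.choose i : ℂ)) *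
        (pd 0 (p - i) (pd 1 i g) * pd 0 i (pd 1 (p - i) h))

variable {p : ℕ}

/-- Index type for the coefficients of a system of binary forms of degrees `n 0, …, n (p-1)`:
the space `V = V_{n 0} ⊕ … ⊕ V_{n (p-1)}` is identified with `Idx n → ℂ`. -/
abbrev Idx (n : Fin p → ℕ) : Type := Σ i : Fin p, Fin (n i + 1)

/-- The binary form of degree `n i` with coefficient vector `c`. -/
def formAt (n : Fin p → ℕ) (c : Idx n → ℂ) (i : Fin p) : MvPolynomial (Fin 2) ℂ :=
  ∑ k : Fin (n i + 1), C (c ⟨i, k⟩) * X 0 ^ (n i - (k : ℕ)) * X 1 ^ (k : ℕ)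

/-- The substitution action of `SL(2,ℂ)` on binary forms: `(g • f)(v) = f (g⁻¹ • v)`. -/
def sl2Act (g : Matrix.SpecialLinearGroup (Fin 2) ℂ) (f : MvPolynomial (Fin 2) ℂ) :
    MvPolynomial (Fin 2) ℂ :=
  aeval (fun i => ∑ j, C ((↑(g⁻¹) : Matrix (Fin 2) (Fin 2) ℂ) i j) * X j) f

/-- The coefficient of `x^(n-k) y^k` in a binary form. -/
def coeffAt (n : Fin p → ℕ) (j : Idx n) (f : MvPolynomial (Fin 2) ℂ) : ℂ :=
  MvPolynomial.coeff
    (Finsupp.single 0 (n j.1 - (j.2 : ℕ)) + Finsupp.single 1 (j.2 : ℕ)) f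

/-- The induced action of `SL(2,ℂ)` on points of `V`, in coefficient coordinates. -/
def actPt (n : Fin p → ℕ) (g : Matrix.SpecialLinearGroup (Fin 2) ℂ) (c : Idx n → ℂ) :
    Idx n → ℂ :=
  fun j => coeffAt n j (sl2Act g (formAt n c j.1))

/-- A polynomial function on `V` is invariant if it is constant on `SL(2,ℂ)`-orbits. -/
def IsInvariant (n : Fin p → ℕ) (P : MvPolynomial (Idx n) ℂ) : Prop :=
  ∀ (g : Matrix.SpecialLinearGroup (Fin 2) ℂ) (c : Idx n → ℂ),
    eval (actPt n g c) P = eval c P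

/-- The invariant ring `R = O(V)^{SL(2,ℂ)}` as a subalgebra of `O(V)`. -/
def invariantRing (n : Fin p → ℕ) : Subalgebra ℂ (MvPolynomial (Idx n) ℂ) where
  carrier := {P | IsInvariant n P}
  mul_mem' := fun ha hb g c => by
    simp only [map_mul]; rw [ha g c, hb g c]
  one_mem' := fun g c => by simp
  add_mem' := fun ha hb g c => by
    simp only [map_add]; rw [ha g c, hb g c]
  zero_mem' := fun g c => by simp
  algebraMap_mem' := fun r g c => by simp

/-- The nullcone: the points of `V` where every homogeneous invariant of positive
degree vanishes. -/
def Nullcone (n : Fin p → ℕ) : Set (Idx n → ℂ) :=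
  {c | ∀ P ∈ invariantRing n, ∀ d : ℕ, 0 < d → P.IsHomogeneous d → eval c P = 0}

/-- `P` is a homogeneous system of parameters of the invariant ring, with degrees `d`:
the `P j` are homogeneous invariants of positive degrees `d j`, algebraically independent
over `ℂ`, and the invariant ring is integral over the subalgebra they generate. -/
def IsHSOP (n : Fin p → ℕ) {k : ℕ} (P : Fin k → MvPolynomial (Idx n) ℂ)
    (d : Fin k → ℕ) : Prop :=
  (∀ j, P j ∈ invariantRing n) ∧ (∀ j, 0 < d j) ∧
    (∀ j, (P j).IsHomogeneous (d j)) ∧ AlgebraicIndependent ℂ P ∧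
    ∀ x ∈ invariantRing n, IsIntegral (↥(Algebra.adjoin ℂ (Set.range P))) x

/-- `r` is the minimal number of generators of the invariant ring. -/
def IsMinimalNumGens (n : Fin p → ℕ) (r : ℕ) : Prop :=
  IsLeast {k | ∃ S : Finset (MvPolynomial (Idx n) ℂ),
    S.card = k ∧ Algebra.adjoin ℂ (S : Set (MvPolynomial (Idx n) ℂ)) = invariantRing n} r

/-- The invariant ring has minimal number of generators `r`, realized by a minimal
system of homogeneous generators of degrees `d 0, …, d (r-1)`. -/
def HasMinimalGens (n : Fin p → ℕ) {r : ℕ} (d : Fin r → ℕ) : Prop :=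
  IsMinimalNumGens n r ∧
    ∃ G : Fin r → MvPolynomial (Idx n) ℂ, Function.Injective G ∧
      (∀ j, (G j).IsHomogeneous (d j)) ∧
      Algebra.adjoin ℂ (Set.range G) = invariantRing n

/-- The generic binary form of degree `n i`, whose coefficients are the corresponding
coordinate functions on `V`. -/
def genForm (n : Fin p → ℕ) (i : Fin p) :
    MvPolynomial (Fin 2) (MvPolynomial (Idx n) ℂ) :=
  ∑ k : Fin (n i + 1), C (X ⟨i, k⟩) * X 0 ^ (n i - (k : ℕ)) * X 1 ^ (k : ℕ)

end BinInv

end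

noncomputable section

namespace BinInv

section Formulas

variable {K : Type*} [CommRing K]

/-- Contraction of a linear form with a vector. -/
def lin (x0 x1 c0 c1 : K) : K := c0 * x0 + c1 * x1

/-- Contraction of a quadratic form with a symmetric bivector. -/
def cw (w0 w1 w2 c0 c1 c2 : K) : K := c0 * w0 + 2 * c1 * w1 + c2 * w2

/-- The value of a quadratic form (with binomially normalised coefficients). -/
def quad (x0 x1 c0 c1 c2 : K) : K := lin x0 x1 (lin x0 x1 c0 c1) (lin x0 x1 c1 c2)

/-- The value of a cubic form (with binomially normalised coefficients). -/
def cub (x0 x1 c0 c1 c2 c3 : K) : K := lin x0 x1 (quad x0 x1 c0 c1 c2) (quad x0 x1 c1 c2 c3)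

/-- The value of a quartic form (with binomially normalised coefficients). -/
def qua (x0 x1 : K) (a : Fin 5 → K) : K :=
  lin x0 x1 (cub x0 x1 (a 0) (a 1) (a 2) (a 3)) (cub x0 x1 (a 1) (a 2) (a 3) (a 4))

/-- For `v = (x, w)` with `x` a vector and `w` a symmetric bivector: the contractions of a quartic
with `x⁴`, `x³(x⌟w)`, `x²w`, `xw(x⌟w)` and `w²`. -/
def qgen (v a : Fin 5 → K) : Fin 5 → K :=
  let x0 := v 0; let x1 := v 1; let w0 := v 2; let w1 := v 3; let w2 := v 4
  ![qua x0 x1 a,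
    lin (x0 * w1 - x1 * w0) (x0 * w2 - x1 * w1)
      (cub x0 x1 (a 0) (a 1) (a 2) (a 3)) (cub x0 x1 (a 1) (a 2) (a 3) (a 4)),
    cw w0 w1 w2 (quad x0 x1 (a 0) (a 1) (a 2)) (quad x0 x1 (a 1) (a 2) (a 3))
      (quad x0 x1 (a 2) (a 3) (a 4)),
    lin (x0 * w1 - x1 * w0) (x0 * w2 - x1 * w1)
      (cw w0 w1 w2 (lin x0 x1 (a 0) (a 1)) (lin x0 x1 (a 1) (a 2)) (lin x0 x1 (a 2) (a 3)))
      (cw w0 w1 w2 (lin x0 x1 (a 1) (a 2)) (lin x0 x1 (a 2) (a 3)) (lin x0 x1 (a 3) (a 4))),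
    a 0 * w0 ^ 2 + 4 * a 1 * w0 * w1 + a 2 * (2 * w0 * w2 + 4 * w1 ^ 2) + 4 * a 3 * w1 * w2
      + a 4 * w2 ^ 2]

/-- Coefficients of the Hessian of a quartic. -/
def hess (a : Fin 5 → K) : Fin 5 → K :=
  ![6 * (a 0 * a 2 - a 1 ^ 2), 3 * (a 0 * a 3 - a 1 * a 2), a 0 * a 4 + 2 * a 1 * a 3 - 3 * a 2 ^ 2,
    3 * (a 1 * a 4 - a 2 * a 3), 6 * (a 2 * a 4 - a 3 ^ 2)]

/-- Coefficients of the sextic covariant of a quartic. -/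
def sext (a : Fin 5 → K) : Fin 7 → K :=
  ![6 * (a 0 ^ 2 * a 3 - 3 * a 0 * a 1 * a 2 + 2 * a 1 ^ 3),
    a 0 ^ 2 * a 4 + 2 * a 0 * a 1 * a 3 - 9 * a 0 * a 2 ^ 2 + 6 * a 1 ^ 2 * a 2,
    2 * (a 0 * a 1 * a 4 + 2 * a 1 ^ 2 * a 3 - 3 * a 0 * a 2 * a 3),
    3 * (a 1 ^ 2 * a 4 - a 0 * a 3 ^ 2),
    -(2 * (a 0 * a 3 * a 4 + 2 * a 1 * a 3 ^ 2 - 3 * a 1 * a 2 * a 4)),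
    -(a 0 * a 4 ^ 2 + 2 * a 1 * a 3 * a 4 - 9 * a 2 ^ 2 * a 4 + 6 * a 2 * a 3 ^ 2),
    -(6 * (a 1 * a 4 ^ 2 - 3 * a 2 * a 3 * a 4 + 2 * a 3 ^ 3))]

/-- The quartic obtained by contracting a sextic twice with a vector. -/
def sq (x0 x1 : K) (t : Fin 7 → K) : Fin 5 → K :=
  ![quad x0 x1 (t 0) (t 1) (t 2), quad x0 x1 (t 1) (t 2) (t 3), quad x0 x1 (t 2) (t 3) (t 4),
    quad x0 x1 (t 3) (t 4) (t 5), quad x0 x1 (t 4) (t 5) (t 6)]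

/-- For `v = (x, w)`: the contractions of a sextic with `x⁶`, `x⁴w`, `x²w²`, `w³`. -/
def sgen (v : Fin 5 → K) (t : Fin 7 → K) : Fin 4 → K :=
  let w0 := v 2; let w1 := v 3; let w2 := v 4
  ![qgen v (sq (v 0) (v 1) t) 0, qgen v (sq (v 0) (v 1) t) 2, qgen v (sq (v 0) (v 1) t) 4,
    t 0 * w0 ^ 3 + 6 * t 1 * w0 ^ 2 * w1 + 3 * t 2 * (w0 ^ 2 * w2 + 4 * w0 * w1 ^ 2)
      + 4 * t 3 * (3 * w0 * w1 * w2 + 2 * w1 ^ 3) + 3 * t 4 * (w0 * w2 ^ 2 + 4 * w1 ^ 2 * w2)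
      + 6 * t 5 * w1 * w2 ^ 2 + t 6 * w2 ^ 3]

theorem sgen_zero (v : Fin 5 → K) (t : Fin 7 → K) : sgen v t 0 = qgen v (sq (v 0) (v 1) t) 0 := rfl

theorem sgen_one (v : Fin 5 → K) (t : Fin 7 → K) : sgen v t 1 = qgen v (sq (v 0) (v 1) t) 2 := rfl

theorem sgen_two (v : Fin 5 → K) (t : Fin 7 → K) : sgen v t 2 = qgen v (sq (v 0) (v 1) t) 4 := rfl

/-- The quadratic invariant of a quartic. -/
def qi (a : Fin 5 → K) : K := a 0 * a 4 - 4 * a 1 * a 3 + 3 * a 2 ^ 2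

/-- The cubic invariant of a quartic. -/
def qj (a : Fin 5 → K) : K :=
  a 0 * a 2 * a 4 + 2 * a 1 * a 2 * a 3 - a 2 ^ 3 - a 0 * a 3 ^ 2 - a 1 ^ 2 * a 4

/-- The contraction of `x²` with the bivector `w`. -/
def vq (v : Fin 5 → K) : K := v 0 ^ 2 * v 4 - 2 * v 0 * v 1 * v 3 + v 1 ^ 2 * v 2

/-- The discriminant of the bivector `w`. -/
def vd (v : Fin 5 → K) : K := v 2 * v 4 - v 3 ^ 2

/-- The (vector, bivector) part of a point. -/
def hd {α : Type*} (c : Fin 10 → α) : Fin 5 → α := ![c 0, c 1, c 2, c 3, c 4]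

/-- The quartic part of a point. -/
def tl {α : Type*} (c : Fin 10 → α) : Fin 5 → α := ![c 5, c 6, c 7, c 8, c 9]

/-- The eighteen generating invariants. -/
def gen (v a : Fin 5 → K) : Fin 18 → K :=
  ![vd v, qi a, qj a, vq v, qgen v a 4, qgen v a 2, qgen v (hess a) 4, qgen v a 0, qgen v a 3,
    qgen v (hess a) 2, qgen v (hess a) 0, qgen v a 1, qgen v (hess a) 3, sgen v (sext a) 3,
    qgen v (hess a) 1, sgen v (sext a) 2, sgen v (sext a) 1, sgen v (sext a) 0]

/-- The eighteen generating invariants, as functions of a vector `(c 0, c 1)`, a symmetric bivector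
`(c 2, c 3, c 4)` and a quartic form `(c 5, …, c 9)`. -/
def gens (c : Fin 10 → K) : Fin 18 → K := gen (hd c) (tl c)

/-- The substitution action of `[[p, q], [r, s]]` on quartic forms. -/
def qact (p q r s : K) (a : Fin 5 → K) : Fin 5 → K :=
  ![qua p r a,
    lin q s (cub p r (a 0) (a 1) (a 2) (a 3)) (cub p r (a 1) (a 2) (a 3) (a 4)),
    quad q s (quad p r (a 0) (a 1) (a 2)) (quad p r (a 1) (a 2) (a 3)) (quad p r (a 2) (a 3) (a 4)),
    lin p r (cub q s (a 0) (a 1) (a 2) (a 3)) (cub q s (a 1) (a 2) (a 3) (a 4)),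
    qua q s a]

/-- The action of the adjugate of `[[p, q], [r, s]]` on pairs (vector, bivector). -/
def vact (p q r s : K) (v : Fin 5 → K) : Fin 5 → K :=
  ![s * v 0 - q * v 1, -r * v 0 + p * v 1,
    s ^ 2 * v 2 - 2 * s * q * v 3 + q ^ 2 * v 4,
    -(s * r) * v 2 + (s * p + q * r) * v 3 - q * p * v 4,
    r ^ 2 * v 2 - 2 * r * p * v 3 + p ^ 2 * v 4]

/-- Assemble a point from its parts. -/
def mk {α : Type*} (v a : Fin 5 → α) : Fin 10 → α :=
  ![v 0, v 1, v 2, v 3, v 4, a 0, a 1, a 2, a 3, a 4]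

/-- The action on triples (vector, bivector, quartic). -/
def act (p q r s : K) (c : Fin 10 → K) : Fin 10 → K :=
  mk (vact p q r s (hd c)) (qact p q r s (tl c))

theorem fin5_eta {α : Type*} (a : Fin 5 → α) : ![a 0, a 1, a 2, a 3, a 4] = a := by
  funext i; fin_cases i <;> rfl

@[simp] theorem hd_mk {α : Type*} (v a : Fin 5 → α) : hd (mk v a) = v := fin5_eta v

@[simp] theorem tl_mk {α : Type*} (v a : Fin 5 → α) : tl (mk v a) = a := fin5_eta a

section Map

variable {L : Type*} [CommRing L] (φ : K →+* L)

theorem map_qgen (v a : Fin 5 → K) (k : Fin 5) : φ (qgen v a k) = qgen (φ ∘ v) (φ ∘ a) k := by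
  fin_cases k <;> simp [qgen, qua, cub, quad, lin, cw, map_ofNat]

theorem map_hess (a : Fin 5 → K) : φ ∘ hess a = hess (φ ∘ a) := by
  funext k; fin_cases k <;> simp [hess, map_ofNat]

theorem map_sext (a : Fin 5 → K) : φ ∘ sext a = sext (φ ∘ a) := by
  funext k; fin_cases k <;> simp [sext, map_ofNat]

theorem map_sq (x0 x1 : K) (t : Fin 7 → K) : φ ∘ sq x0 x1 t = sq (φ x0) (φ x1) (φ ∘ t) := by
  funext k; fin_cases k <;> simp [sq, quad, lin]

theorem map_sgen (v : Fin 5 → K) (t : Fin 7 → K) (k : Fin 4) :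
    φ (sgen v t k) = sgen (φ ∘ v) (φ ∘ t) k := by
  fin_cases k <;> simp [sgen, map_qgen, map_sq, map_ofNat]

theorem map_gen (v a : Fin 5 → K) (k : Fin 18) : φ (gen v a k) = gen (φ ∘ v) (φ ∘ a) k := by
  fin_cases k <;> simp [gen, map_qgen, map_sgen, map_hess, map_sext, vd, vq, qi, qj, map_ofNat]

theorem map_mk (v a : Fin 5 → K) : φ ∘ mk v a = mk (φ ∘ v) (φ ∘ a) := by
  funext i; fin_cases i <;> rfl

theorem map_hd (c : Fin 10 → K) : φ ∘ hd c = hd (φ ∘ c) := by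
  funext i; fin_cases i <;> rfl

theorem map_tl (c : Fin 10 → K) : φ ∘ tl c = tl (φ ∘ c) := by
  funext i; fin_cases i <;> rfl

theorem map_gens (c : Fin 10 → K) (k : Fin 18) : φ (gens c k) = gens (φ ∘ c) k := by
  rw [gens, map_gen, map_hd, map_tl, gens]

end Map

theorem qact_qact (p q r s p' q' r' s' : K) (a : Fin 5 → K) :
    qact p q r s (qact p' q' r' s' a) =
      qact (p' * p + q' * r) (p' * q + q' * s) (r' * p + s' * r) (r' * q + s' * s) a := by
  funext i
  fin_cases i <;> simp [qua, cub, quad, lin, qact] <;> ring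

theorem vact_vact (p q r s p' q' r' s' : K) (v : Fin 5 → K) :
    vact p q r s (vact p' q' r' s' v) =
      vact (p' * p + q' * r) (p' * q + q' * s) (r' * p + s' * r) (r' * q + s' * s) v := by
  funext i
  fin_cases i <;> simp [vact] <;> ring

theorem act_act (p q r s p' q' r' s' : K) (c : Fin 10 → K) :
    act p q r s (act p' q' r' s' c) =
      act (p' * p + q' * r) (p' * q + q' * s) (r' * p + s' * r) (r' * q + s' * s) c := by
  simp only [act, hd_mk, tl_mk, qact_qact, vact_vact]

end Formulas

section Invariance

variable {K : Type*} [CommRing K]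

/-- The action of an upper unipotent matrix on sextic forms. -/
def sactU (u : K) (t : Fin 7 → K) : Fin 7 → K :=
  ![t 0, t 1 + u * t 0, t 2 + 2 * u * t 1 + u ^ 2 * t 0,
    t 3 + 3 * u * t 2 + 3 * u ^ 2 * t 1 + u ^ 3 * t 0,
    t 4 + 4 * u * t 3 + 6 * u ^ 2 * t 2 + 4 * u ^ 3 * t 1 + u ^ 4 * t 0,
    t 5 + 5 * u * t 4 + 10 * u ^ 2 * t 3 + 10 * u ^ 3 * t 2 + 5 * u ^ 4 * t 1 + u ^ 5 * t 0,
    t 6 + 6 * u * t 5 + 15 * u ^ 2 * t 4 + 20 * u ^ 3 * t 3 + 15 * u ^ 4 * t 2 + 6 * u ^ 5 * t 1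
      + u ^ 6 * t 0]

theorem vact_upper (u : K) (v : Fin 5 → K) :
    vact 1 u 0 1 v = ![v 0 - u * v 1, v 1, v 2 - 2 * u * v 3 + u ^ 2 * v 4, v 3 - u * v 4, v 4] := by
  funext i; fin_cases i <;> simp [vact]

theorem qact_upper (u : K) (a : Fin 5 → K) :
    qact 1 u 0 1 a = ![a 0, a 1 + u * a 0, a 2 + 2 * u * a 1 + u ^ 2 * a 0,
      a 3 + 3 * u * a 2 + 3 * u ^ 2 * a 1 + u ^ 3 * a 0,
      a 4 + 4 * u * a 3 + 6 * u ^ 2 * a 2 + 4 * u ^ 3 * a 1 + u ^ 4 * a 0] := by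
  funext i; fin_cases i <;> simp [qact, qua, cub, quad, lin] <;> ring

theorem qgen_upper (u : K) (v a : Fin 5 → K) (k : Fin 5) :
    qgen (vact 1 u 0 1 v) (qact 1 u 0 1 a) k = qgen v a k := by
  rw [vact_upper, qact_upper]
  fin_cases k <;> simp [qgen, qua, cub, quad, lin, cw] <;> ring

theorem hess_upper (u : K) (a : Fin 5 → K) : hess (qact 1 u 0 1 a) = qact 1 u 0 1 (hess a) := by
  simp only [qact_upper]
  funext k; fin_cases k <;> simp [hess] <;> ring

theorem sext_upper (u : K) (a : Fin 5 → K) : sext (qact 1 u 0 1 a) = sactU u (sext a) := by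
  rw [qact_upper]
  funext k; fin_cases k <;> simp [sext, sactU] <;> ring

theorem sq_upper (u x0 x1 : K) (t : Fin 7 → K) :
    sq (x0 - u * x1) x1 (sactU u t) = qact 1 u 0 1 (sq x0 x1 t) := by
  rw [qact_upper]
  funext k; fin_cases k <;> simp [sq, sactU, quad, lin] <;> ring

theorem sgen_upper (u : K) (v : Fin 5 → K) (t : Fin 7 → K) (k : Fin 4) :
    sgen (vact 1 u 0 1 v) (sactU u t) k = sgen v t k := by
  have h : sq ((vact 1 u 0 1 v) 0) ((vact 1 u 0 1 v) 1) (sactU u t)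
      = qact 1 u 0 1 (sq (v 0) (v 1) t) := by
    rw [← sq_upper, vact_upper]; rfl
  fin_cases k
  · show sgen _ _ 0 = sgen _ _ 0
    rw [sgen_zero, sgen_zero, h, qgen_upper]
  · show sgen _ _ 1 = sgen _ _ 1
    rw [sgen_one, sgen_one, h, qgen_upper]
  · show sgen _ _ 2 = sgen _ _ 2
    rw [sgen_two, sgen_two, h, qgen_upper]
  · simp [sgen, vact_upper, sactU]; ring

theorem gen_upper (u : K) (v a : Fin 5 → K) :
    gen (vact 1 u 0 1 v) (qact 1 u 0 1 a) = gen v a := by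
  have h1 : vd (vact 1 u 0 1 v) = vd v := by rw [vact_upper]; simp [vd]; ring
  have h2 : vq (vact 1 u 0 1 v) = vq v := by rw [vact_upper]; simp [vq]; ring
  have h3 : qi (qact 1 u 0 1 a) = qi a := by rw [qact_upper]; simp [qi]; ring
  have h4 : qj (qact 1 u 0 1 a) = qj a := by rw [qact_upper]; simp [qj]; ring
  simp only [gen, h1, h2, h3, h4, hess_upper, sext_upper, sgen_upper, qgen_upper]

theorem gens_upper (u : K) (c : Fin 10 → K) : gens (act 1 u 0 1 c) = gens c := by
  simp only [gens, act, hd_mk, tl_mk, gen_upper]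


theorem vact_flip (v : Fin 5 → K) :
    vact 0 1 (-1) 0 v = ![-v 1, v 0, v 4, -v 3, v 2] := by
  funext i; fin_cases i <;> simp [vact]

theorem qact_flip (a : Fin 5 → K) : qact 0 1 (-1) 0 a = ![a 4, -a 3, a 2, -a 1, a 0] := by
  funext i; fin_cases i <;> simp [qact, qua, cub, quad, lin]

theorem qgen_flip (v a : Fin 5 → K) (k : Fin 5) :
    qgen (vact 0 1 (-1) 0 v) (qact 0 1 (-1) 0 a) k = qgen v a k := by
  rw [vact_flip, qact_flip]
  fin_cases k <;> simp [qgen, qua, cub, quad, lin, cw] <;> ring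

theorem hess_flip (a : Fin 5 → K) : hess (qact 0 1 (-1) 0 a) = qact 0 1 (-1) 0 (hess a) := by
  simp only [qact_flip]
  funext k; fin_cases k <;> simp [hess] <;> ring

theorem sext_flip (a : Fin 5 → K) : sext (qact 0 1 (-1) 0 a) =
    ![sext a 6, -sext a 5, sext a 4, -sext a 3, sext a 2, -sext a 1, sext a 0] := by
  rw [qact_flip]
  funext k; fin_cases k <;> simp [sext] <;> ring

theorem sq_flip (x0 x1 : K) (t : Fin 7 → K) :
    sq (-x1) x0 ![t 6, -t 5, t 4, -t 3, t 2, -t 1, t 0] = qact 0 1 (-1) 0 (sq x0 x1 t) := by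
  rw [qact_flip]
  funext k; fin_cases k <;> simp [sq, quad, lin] <;> ring

theorem sgen_flip (v : Fin 5 → K) (t : Fin 7 → K) (k : Fin 4) :
    sgen (vact 0 1 (-1) 0 v) ![t 6, -t 5, t 4, -t 3, t 2, -t 1, t 0] k = sgen v t k := by
  have h : sq ((vact 0 1 (-1) 0 v) 0) ((vact 0 1 (-1) 0 v) 1)
      ![t 6, -t 5, t 4, -t 3, t 2, -t 1, t 0] = qact 0 1 (-1) 0 (sq (v 0) (v 1) t) := by
    rw [← sq_flip, vact_flip]; rfl
  fin_cases k
  · show sgen _ _ 0 = sgen _ _ 0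
    rw [sgen_zero, sgen_zero, h, qgen_flip]
  · show sgen _ _ 1 = sgen _ _ 1
    rw [sgen_one, sgen_one, h, qgen_flip]
  · show sgen _ _ 2 = sgen _ _ 2
    rw [sgen_two, sgen_two, h, qgen_flip]
  · simp [sgen, vact_flip]; ring

theorem gen_flip (v a : Fin 5 → K) :
    gen (vact 0 1 (-1) 0 v) (qact 0 1 (-1) 0 a) = gen v a := by
  have h1 : vd (vact 0 1 (-1) 0 v) = vd v := by rw [vact_flip]; simp [vd]; ring
  have h2 : vq (vact 0 1 (-1) 0 v) = vq v := by rw [vact_flip]; simp [vq]; ring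
  have h3 : qi (qact 0 1 (-1) 0 a) = qi a := by rw [qact_flip]; simp [qi]; ring
  have h4 : qj (qact 0 1 (-1) 0 a) = qj a := by rw [qact_flip]; simp [qj]; ring
  simp only [gen, h1, h2, h3, h4, hess_flip, sext_flip, sgen_flip, qgen_flip]

theorem gens_flip (c : Fin 10 → K) : gens (act 0 1 (-1) 0 c) = gens c := by
  simp only [gens, act, hd_mk, tl_mk, gen_flip]

theorem gens_lower (u : K) (c : Fin 10 → K) : gens (act 1 0 u 1 c) = gens c := by
  have h : act 0 1 (-1) 0 (act 1 0 u 1 c) = act 1 (-u) 0 1 (act 0 1 (-1) 0 c) := by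
    simp only [act_act]; congr 1 <;> ring
  rw [← gens_flip (act 1 0 u 1 c), h, gens_upper, gens_flip]

end Invariance

theorem gens_act {K : Type*} [Field K] {p q r s : K} (h : p * s - q * r = 1) (c : Fin 10 → K) :
    gens (act p q r s c) = gens c := by
  have key : ∀ {p q r s : K}, p * s - q * r = 1 → r ≠ 0 → ∀ c : Fin 10 → K,
      gens (act p q r s c) = gens c := by
    intro p q r s h hr c
    have e : act p q r s c
        = act 1 ((s - 1) / r) 0 1 (act 1 0 r 1 (act 1 ((p - 1) / r) 0 1 c)) := by
      simp only [act_act]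
      congr 1 <;> field_simp <;> first | ring1 | linear_combination -h
    rw [e, gens_upper, gens_lower, gens_upper]
  by_cases hr : r = 0
  · have hp : p ≠ 0 := by
      rintro rfl; simp [hr] at h
    have h2 := key (p := p) (q := q) (r := p + r) (s := q + s) (by linear_combination h)
      (by simpa [hr] using hp) (act 1 0 (-1) 1 c)
    have e2 : act p q (p + r) (q + s) (act 1 0 (-1) 1 c) = act p q r s c := by
      rw [act_act]; congr 1 <;> ring
    rw [← e2, h2, gens_lower]
  · exact key h hr c

theorem eval_eq_zero_of_mul {σ : Type*} {P Q : MvPolynomial σ ℂ} (hQ : Q ≠ 0)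
    (h : ∀ c, eval c Q ≠ 0 → eval c P = 0) : P = 0 := by
  have : P * Q = 0 := by
    apply MvPolynomial.funext
    intro c
    by_cases hc : eval c Q = 0
    · simp [hc]
    · simp [h c hc]
  exact (mul_eq_zero.1 this).resolve_right hQ

section Scaling

variable {σ τ : Type*}

/-- Restriction of a polynomial to the curve `s ↦ s ^ w • c`. -/
def curve (w : σ → ℕ) (c : σ → ℂ) : MvPolynomial σ ℂ →ₐ[ℂ] Polynomial ℂ :=
  aeval fun i => Polynomial.C (c i) * Polynomial.X ^ w i

theorem eval_curve (w : σ → ℕ) (c : σ → ℂ) (P : MvPolynomial σ ℂ) (s : ℂ) :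
    (curve w c P).eval s = eval (fun i => s ^ w i * c i) P := by
  have h : (Polynomial.evalRingHom s).comp (curve w c).toRingHom
      = eval (fun i => s ^ w i * c i) := by
    apply MvPolynomial.ringHom_ext
    · intro r; simp [curve]
    · intro i; simp only [curve, AlgHom.toRingHom_eq_coe, RingHom.comp_apply, RingHom.coe_coe,
        aeval_X, Polynomial.coe_evalRingHom, eval_X]; simp only [Polynomial.eval_mul,
        Polynomial.eval_C, Polynomial.eval_pow, Polynomial.eval_X]; ring
  exact congrArg (fun f => f P) h

theorem curve_monomial (w : σ → ℕ) (c : σ → ℂ) (d : σ →₀ ℕ) (r : ℂ) :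
    curve w c (monomial d r)
      = Polynomial.C (eval c (monomial d r)) * Polynomial.X ^ (Finsupp.weight w d) := by
  simp only [curve, aeval_monomial, eval_monomial, Finsupp.prod, mul_pow, Finset.prod_mul_distrib,
    Finsupp.weight_apply, Finsupp.sum, Polynomial.C_mul, map_prod, Polynomial.C_pow, ← pow_mul,
    Finset.prod_pow_eq_pow_sum, smul_eq_mul, Polynomial.algebraMap_eq, mul_comm (d _) (w _)]
  ring

theorem coeff_curve (w : σ → ℕ) (c : σ → ℂ) (P : MvPolynomial σ ℂ) (k : ℕ) :
    (curve w c P).coeff k = eval c (weightedHomogeneousComponent w k P) := by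
  induction P using MvPolynomial.induction_on' with
  | monomial d r =>
    rw [curve_monomial, Polynomial.coeff_C_mul_X_pow]
    split_ifs with h
    · rw [(isWeightedHomogeneous_monomial w d r h.symm).weightedHomogeneousComponent_same]
    · rw [(isWeightedHomogeneous_monomial w d r rfl).weightedHomogeneousComponent_ne k
        (fun h' => h h'), map_zero]
  | add p q hp hq => simp only [map_add, Polynomial.coeff_add, hp, hq]

theorem eval_smul_of_isWeightedHomogeneous {w : σ → ℕ} {k : ℕ} {P : MvPolynomial σ ℂ}
    (h : IsWeightedHomogeneous w P k) (s : ℂ) (c : σ → ℂ) :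
    eval (fun i => s ^ w i * c i) P = s ^ k * eval c P := by
  have e : curve w c P = Polynomial.C (eval c P) * Polynomial.X ^ k := by
    ext m
    rw [coeff_curve, Polynomial.coeff_C_mul_X_pow]
    split_ifs with hm
    · rw [hm, h.weightedHomogeneousComponent_same]
    · rw [h.weightedHomogeneousComponent_ne m hm, map_zero]
  rw [← eval_curve, e, Polynomial.eval_C_mul, Polynomial.eval_pow, Polynomial.eval_X, mul_comm]

theorem polynomial_ext_of_ne_zero {f g : Polynomial ℂ} (h : ∀ s : ℂ, s ≠ 0 → f.eval s = g.eval s) :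
    f = g :=
  Polynomial.eq_of_infinite_eval_eq f g
    ((Set.finite_singleton (0 : ℂ)).infinite_compl.mono fun s hs => h s hs)

theorem eval_component_eq {w : σ → ℕ} {w' : τ → ℕ} {c : σ → ℂ} {c' : τ → ℂ}
    {P : MvPolynomial σ ℂ} {Q : MvPolynomial τ ℂ}
    (h : ∀ s : ℂ, s ≠ 0 → eval (fun i => s ^ w i * c i) P = eval (fun i => s ^ w' i * c' i) Q)
    (k : ℕ) : eval c (weightedHomogeneousComponent w k P)
      = eval c' (weightedHomogeneousComponent w' k Q) := by
  rw [← coeff_curve, ← coeff_curve, polynomial_ext_of_ne_zero (f := curve w c P)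
    (g := curve w' c' Q) fun s hs => by rw [eval_curve, eval_curve, h s hs]]

theorem eval_component_of_scaling {w : σ → ℕ} {c : σ → ℂ} {P : MvPolynomial σ ℂ} {r : ℂ} {n : ℕ}
    (h : ∀ s : ℂ, s ≠ 0 → eval (fun i => s ^ w i * c i) P = s ^ n * r) :
    eval c (weightedHomogeneousComponent w n P) = r := by
  have e : curve w c P = Polynomial.C r * Polynomial.X ^ n :=
    polynomial_ext_of_ne_zero fun s hs => by rw [eval_curve, h s hs, Polynomial.eval_C_mul,
      Polynomial.eval_pow, Polynomial.eval_X, mul_comm]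
  rw [← coeff_curve, e]; simp

theorem sum_component [Finite σ] (w : σ → ℕ) (P : MvPolynomial σ ℂ) :
    ∃ N, P = ∑ k ∈ Finset.range N, weightedHomogeneousComponent w k P := by
  refine ⟨weightedTotalDegree w P + 1, ?_⟩
  apply MvPolynomial.funext
  intro c
  have hN : ∀ k, weightedTotalDegree w P + 1 ≤ k → weightedHomogeneousComponent w k P = 0 :=
    fun k hk => weightedHomogeneousComponent_eq_zero k P hk
  have e : curve w c P = ∑ k ∈ Finset.range (weightedTotalDegree w P + 1),
      Polynomial.C (eval c (weightedHomogeneousComponent w k P)) * Polynomial.X ^ k := by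
    ext m
    rw [coeff_curve, Polynomial.finsetSum_coeff]
    simp only [Polynomial.coeff_C_mul_X_pow]
    rw [Finset.sum_ite_eq]
    split_ifs with hm
    · rfl
    · rw [hN m (by simpa using hm), map_zero]
  have := congrArg (Polynomial.eval 1) e
  rw [eval_curve, Polynomial.eval_finsetSum] at this
  simpa using this

theorem isWeightedHomogeneous_of_eval [Finite σ] {w : σ → ℕ} {P : MvPolynomial σ ℂ} {n : ℕ}
    (h : ∀ s : ℂ, s ≠ 0 → ∀ c, eval (fun i => s ^ w i * c i) P = s ^ n * eval c P) :
    IsWeightedHomogeneous w P n := by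
  have : weightedHomogeneousComponent w n P = P := MvPolynomial.funext fun c =>
    eval_component_of_scaling fun s hs => h s hs c
  have h2 := weightedHomogeneousComponent_mem w P n
  rwa [this] at h2

theorem component_eq_zero_of_mul {w : σ → ℕ} {P q : MvPolynomial σ ℂ} {m n k : ℕ} (hq0 : q ≠ 0)
    (hq : IsWeightedHomogeneous w q m) (h : IsWeightedHomogeneous w (q * P) n) (hk : k + m ≠ n) :
    weightedHomogeneousComponent w k P = 0 := by
  refine eval_eq_zero_of_mul hq0 fun c hc => ?_
  have e : ∀ {R : MvPolynomial σ ℂ} {d : ℕ}, IsWeightedHomogeneous w R d →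
      curve w c R = Polynomial.C (eval c R) * Polynomial.X ^ d := fun {R d} hR =>
    polynomial_ext_of_ne_zero fun s _ => by
      rw [eval_curve, eval_smul_of_isWeightedHomogeneous hR, Polynomial.eval_C_mul,
        Polynomial.eval_pow, Polynomial.eval_X, mul_comm]
  have h1 := e h
  rw [map_mul, e hq, mul_assoc] at h1
  have h2 := congrArg (fun f => Polynomial.coeff f (k + m)) h1
  simp only [Polynomial.coeff_C_mul, Polynomial.coeff_X_pow, if_neg hk, mul_zero,
    Polynomial.coeff_X_pow_mul, coeff_curve] at h2
  exact (mul_eq_zero.1 h2).resolve_left hc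

end Scaling

theorem eval_aeval {σ τ : Type*} (c : τ → ℂ) (g : σ → MvPolynomial τ ℂ) (S : MvPolynomial σ ℂ) :
    eval c (aeval g S) = eval (fun i => eval c (g i)) S := by
  have h : (eval c).comp (aeval g : MvPolynomial σ ℂ →ₐ[ℂ] MvPolynomial τ ℂ).toRingHom
      = eval (fun i => eval c (g i)) := by
    apply MvPolynomial.ringHom_ext
    · intro r; simp
    · intro i; simp
  exact congrArg (fun f => f S) h

theorem eval_comp_X {σ : Type*} (c : σ → ℂ) : (eval c : MvPolynomial σ ℂ → ℂ) ∘ X = c :=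
  funext fun i => eval_X i

theorem dvd_of_vanish {σ : Type*} [Finite σ] {q P : MvPolynomial σ ℂ} (hq : Irreducible q)
    (h : ∀ c, eval c q = 0 → eval c P = 0) : q ∣ P := by
  have : (Ideal.span {q}).IsPrime :=
    (Ideal.span_singleton_prime hq.ne_zero).2 hq.prime
  rw [← Ideal.mem_span_singleton, ← MvPolynomial.IsPrime.vanishingIdeal_zeroLocus
    (K := ℂ) (Ideal.span {q})]
  intro c hc
  have := hc q (Ideal.mem_span_singleton_self q)
  simp only [aeval_eq_eval] at this ⊢
  exact h c this

/-- Leading coefficients of the covariants of a quartic (and its two invariants). -/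
def cov {K : Type*} [CommRing K] (a : Fin 5 → K) : Fin 5 → K :=
  ![a 0, hess a 0, sext a 0, qi a, qj a]

theorem cov_relation {K : Type*} [CommRing K] (a : Fin 5 → K) :
    3 * cov a 2 ^ 2 = cov a 0 ^ 2 * (18 * cov a 1 * cov a 3 - 108 * cov a 0 * cov a 4)
      - 2 * cov a 1 ^ 3 := by
  simp [cov, hess, sext, qi, qj]; ring

theorem map_cov {K L : Type*} [CommRing K] [CommRing L] (φ : K →+* L) (a : Fin 5 → K) :
    φ ∘ cov a = cov (φ ∘ a) := by
  funext k; fin_cases k <;> simp [cov, hess, sext, qi, qj, map_ofNat]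

theorem eval_aeval_cov (a : Fin 5 → ℂ) (S : MvPolynomial (Fin 5) ℂ) :
    eval a (aeval (cov (X : Fin 5 → MvPolynomial (Fin 5) ℂ)) S) = eval (cov a) S := by
  rw [eval_aeval]
  congr 2
  have := map_cov (eval a) (X : Fin 5 → MvPolynomial (Fin 5) ℂ)
  rwa [eval_comp_X] at this

theorem eq_cov_of_ne_zero {p S : MvPolynomial (Fin 5) ℂ}
    (h : ∀ a : Fin 5 → ℂ, a 0 ≠ 0 → eval a p = eval (cov a) S) (a : Fin 5 → ℂ) :
    eval a p = eval (cov a) S := by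
  have : p - aeval (cov (X : Fin 5 → MvPolynomial (Fin 5) ℂ)) S = 0 := by
    refine eval_eq_zero_of_mul (X_ne_zero 0) fun a ha => ?_
    rw [map_sub, eval_aeval_cov, h a (by simpa using ha), sub_self]
  rw [← eval_aeval_cov, sub_eq_zero.1 this]

theorem exists_slice (p : MvPolynomial (Fin 5) ℂ) :
    ∃ (N : ℕ) (S : MvPolynomial (Fin 5) ℂ), ∀ a : Fin 5 → ℂ, a 0 ≠ 0 →
      a 0 ^ N * eval (qact 1 (-(a 1 / a 0)) 0 1 a) p = eval (cov a) S := by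
  induction p using MvPolynomial.induction_on with
  | C r => exact ⟨0, C r, fun a _ => by simp⟩
  | add p q hp hq =>
    obtain ⟨N, S, hS⟩ := hp
    obtain ⟨M, T, hT⟩ := hq
    refine ⟨N + M, X 0 ^ M * S + X 0 ^ N * T, fun a ha => ?_⟩
    simp only [map_add, map_mul, map_pow, eval_X, ← hS a ha, ← hT a ha]
    simp only [cov, Matrix.cons_val_zero]; ring
  | mul_X p i hp =>
    obtain ⟨N, S, hS⟩ := hp
    have key : ∃ T : MvPolynomial (Fin 5) ℂ, ∀ a : Fin 5 → ℂ, a 0 ≠ 0 →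
        a 0 ^ 3 * qact 1 (-(a 1 / a 0)) 0 1 a i = eval (cov a) T := by
      refine ⟨![X 0 ^ 4, 0, C (1/6) * X 0 ^ 2 * X 1, C (1/6) * X 0 * X 2,
        X 0 ^ 2 * X 3 - C (1/12) * X 1 ^ 2] i, fun a ha => ?_⟩
      rw [qact_upper]
      fin_cases i <;> simp [cov, hess, sext, qi] <;> field_simp <;> ring_nf <;> simp
    obtain ⟨T, hT⟩ := key
    refine ⟨N + 3, S * T, fun a ha => ?_⟩
    rw [map_mul, map_mul, ← hS a ha, ← hT a ha, eval_X]; ring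

theorem cov_reduce (S : MvPolynomial (Fin 5) ℂ) :
    ∃ (Q : MvPolynomial (Fin 5) ℂ) (r s : MvPolynomial (Fin 3) ℂ), ∀ a : Fin 5 → ℂ,
      eval (cov a) S = a 0 * eval (cov a) Q + eval ![hess a 0, qi a, qj a] r
        + sext a 0 * eval ![hess a 0, qi a, qj a] s := by
  induction S using MvPolynomial.induction_on with
  | C r => exact ⟨0, C r, 0, fun a => by simp⟩
  | add p q hp hq =>
    obtain ⟨Q, r, s, h⟩ := hp
    obtain ⟨Q', r', s', h'⟩ := hq
    exact ⟨Q + Q', r + r', s + s', fun a => by simp only [map_add, h a, h' a]; ring⟩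
  | mul_X p i hp =>
    obtain ⟨Q, r, s, h⟩ := hp
    fin_cases i
    · exact ⟨p, 0, 0, fun a => by simp [cov]; ring⟩
    · exact ⟨Q * X 1, r * X 0, s * X 0, fun a => by
        simp only [map_mul, h a]; simp [cov]; ring⟩
    · refine ⟨Q * X 2 + rename ![1, 3, 4] s * (X 0 * (C 6 * X 1 * X 3 - C 36 * X 0 * X 4)),
        - (s * C (2 / 3) * X 0 ^ 3), r, fun a => ?_⟩
      have e : eval (cov a) (rename ![1, 3, 4] s) = eval ![hess a 0, qi a, qj a] s := by
        rw [eval_rename]; congr 2; funext i; fin_cases i <;> rfl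
      have rel := cov_relation a
      simp only [map_mul, h a, e, map_add]
      simp [cov] at rel ⊢
      linear_combination (1 / 3) * rel * eval ![hess a 0, qi a, qj a] s
    · exact ⟨Q * X 3, r * X 1, s * X 1, fun a => by
        simp only [map_mul, h a]; simp [cov]; ring⟩
    · exact ⟨Q * X 4, r * X 2, s * X 2, fun a => by
        simp only [map_mul, h a]; simp [cov]; ring⟩

theorem cov_saturated {p S : MvPolynomial (Fin 5) ℂ}
    (h : ∀ a : Fin 5 → ℂ, a 0 * eval a p = eval (cov a) S) :
    ∃ T : MvPolynomial (Fin 5) ℂ, ∀ a, eval a p = eval (cov a) T := by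
  obtain ⟨Q, r, s, hQ⟩ := cov_reduce S
  have key : ∀ c : ℂ, c ≠ 0 → ∀ i j : ℂ,
      eval ![-(6 * c ^ 2), i, j] r + 12 * c ^ 3 * eval ![-(6 * c ^ 2), i, j] s = 0 := by
    intro c hc i j
    have := hQ ![0, c, 0, -i / (4 * c), -j / c ^ 2]
    rw [← h] at this
    have e : (![hess ![0, c, 0, -i / (4 * c), -j / c ^ 2] 0, qi ![0, c, 0, -i / (4 * c), -j / c ^ 2],
        qj ![0, c, 0, -i / (4 * c), -j / c ^ 2]] : Fin 3 → ℂ) = ![-(6 * c ^ 2), i, j] := by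
      funext k; fin_cases k <;> simp [hess, qi, qj] <;> field_simp
    rw [e] at this
    simp [sext] at this
    rw [← sub_eq_zero] at this
    linear_combination -this
  have key2 : ∀ c : ℂ, c ≠ 0 → ∀ i j : ℂ,
      eval ![-(6 * c ^ 2), i, j] r = 0 ∧ eval ![-(6 * c ^ 2), i, j] s = 0 := by
    intro c hc i j
    have h1 := key c hc i j
    have h2 := key (-c) (neg_ne_zero.2 hc) i j
    rw [neg_sq] at h2
    have h3 : 24 * c ^ 3 * eval ![-(6 * c ^ 2), i, j] s = 0 := by linear_combination h1 - h2
    have h4 : eval ![-(6 * c ^ 2), i, j] s = 0 := by simpa [hc] using h3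
    exact ⟨by rwa [h4, mul_zero, add_zero] at h1, h4⟩
  have key3 : ∀ x : Fin 3 → ℂ, x 0 ≠ 0 → eval x r = 0 ∧ eval x s = 0 := by
    intro x hx
    obtain ⟨c, hc⟩ := IsAlgClosed.exists_pow_nat_eq (-x 0 / 6) (n := 2) (by norm_num)
    have hc0 : c ≠ 0 := by
      rintro rfl; apply hx; field_simp at hc; simpa using hc
    have e : x = ![-(6 * c ^ 2), x 1, x 2] := by
      funext k; fin_cases k <;> simp [hc]; ring
    rw [e]
    exact key2 c hc0 _ _
  have hr : r = 0 := eval_eq_zero_of_mul (X_ne_zero 0) fun x hx => (key3 x (by simpa using hx)).1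
  have hs : s = 0 := eval_eq_zero_of_mul (X_ne_zero 0) fun x hx => (key3 x (by simpa using hx)).2
  refine ⟨Q, eq_cov_of_ne_zero fun a ha => mul_left_cancel₀ ha ?_⟩
  rw [h, hQ, hr, hs]; simp

/-- A polynomial in the coefficients of a quartic that is invariant under upper unipotent
substitutions is a polynomial in the leading coefficients of the basic covariants. -/
theorem exists_cov {p : MvPolynomial (Fin 5) ℂ}
    (h : ∀ (u : ℂ) (a : Fin 5 → ℂ), eval (qact 1 u 0 1 a) p = eval a p) :
    ∃ S : MvPolynomial (Fin 5) ℂ, ∀ a, eval a p = eval (cov a) S := by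
  obtain ⟨N, S, hS⟩ := exists_slice p
  have hS' : ∀ a : Fin 5 → ℂ, eval a (X 0 ^ N * p) = eval (cov a) S :=
    eq_cov_of_ne_zero fun a ha => by simpa [h] using hS a ha
  clear hS
  induction N generalizing S with
  | zero => exact ⟨S, by simpa using hS'⟩
  | succ N ih =>
    obtain ⟨T, hT⟩ := cov_saturated (p := X 0 ^ N * p) (S := S) fun a => by
      rw [← hS' a]; simp; ring
    exact ih T hT

section NineFormulas

variable {K : Type*} [CommRing K]

/-- The quartic part of a point `(x, y, a)`. -/
def tl9 {α : Type*} (e : Fin 9 → α) : Fin 5 → α := ![e 4, e 5, e 6, e 7, e 8]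

/-- Square the vector `y` in `(x, y, a)`. -/
def sqz (e : Fin 9 → K) : Fin 10 → K :=
  ![e 0, e 1, e 2 ^ 2, e 2 * e 3, e 3 ^ 2, e 4, e 5, e 6, e 7, e 8]

/-- The bracket of the two vectors. -/
def zf (e : Fin 9 → K) : K := e 0 * e 3 - e 1 * e 2

/-- The action on triples (vector, vector, quartic). -/
def act9 (p q r s : K) (e : Fin 9 → K) : Fin 9 → K :=
  ![s * e 0 - q * e 1, -r * e 0 + p * e 1, s * e 2 - q * e 3, -r * e 2 + p * e 3,
    qact p q r s (tl9 e) 0, qact p q r s (tl9 e) 1, qact p q r s (tl9 e) 2,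
    qact p q r s (tl9 e) 3, qact p q r s (tl9 e) 4]

theorem sqz_act9 (p q r s : K) (e : Fin 9 → K) : sqz (act9 p q r s e) = act p q r s (sqz e) := by
  funext i
  fin_cases i <;> simp [sqz, act9, act, mk, vact, hd, tl, tl9] <;> ring

theorem zf_act9 {p q r s : K} (h : p * s - q * r = 1) (e : Fin 9 → K) :
    zf (act9 p q r s e) = zf e := by
  simp [zf, act9]; linear_combination (e 0 * e 3 - e 1 * e 2) * h

/-- Polarizations of a quartic along `x` and `y`. -/
def pol4 (e : Fin 9 → K) (a : Fin 5 → K) : Fin 5 → K := qact (e 0) (e 2) (e 1) (e 3) a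

/-- Polarizations of a sextic along `x` and `y`. -/
def pol6 (e : Fin 9 → K) (t : Fin 7 → K) : Fin 7 → K :=
  ![pol4 e (sq (e 0) (e 1) t) 0, pol4 e (sq (e 0) (e 1) t) 1, pol4 e (sq (e 0) (e 1) t) 2,
    pol4 e (sq (e 0) (e 1) t) 3, pol4 e (sq (e 0) (e 1) t) 4, pol4 e (sq (e 2) (e 3) t) 3,
    pol4 e (sq (e 2) (e 3) t) 4]

theorem qgen_sqz (e : Fin 9 → K) (a : Fin 5 → K) :
    qgen (hd (sqz e)) a = ![pol4 e a 0, zf e * pol4 e a 1, pol4 e a 2, zf e * pol4 e a 3,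
      pol4 e a 4] := by
  funext k
  fin_cases k <;> simp [qgen, pol4, hd, sqz, qact, zf, qua, cub, quad, lin, cw] <;> ring

theorem sgen_sqz (e : Fin 9 → K) (t : Fin 7 → K) :
    sgen (hd (sqz e)) t = ![pol6 e t 0, pol6 e t 2, pol6 e t 4, pol6 e t 6] := by
  have h0 : hd (sqz e) 0 = e 0 := rfl
  have h1 : hd (sqz e) 1 = e 1 := rfl
  funext k
  fin_cases k
  · simp [sgen, h0, h1, qgen_sqz, pol6]
  · simp [sgen, h0, h1, qgen_sqz, pol6]
  · simp [sgen, h0, h1, qgen_sqz, pol6]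
  · simp [sgen, pol6, hd, sqz, pol4, qact, sq, qua, cub, quad, lin]; ring

theorem gens_sqz (e : Fin 9 → K) :
    gens (sqz e) = ![0, qi (tl9 e), qj (tl9 e), zf e ^ 2, pol4 e (tl9 e) 4, pol4 e (tl9 e) 2,
      pol4 e (hess (tl9 e)) 4, pol4 e (tl9 e) 0, zf e * pol4 e (tl9 e) 3, pol4 e (hess (tl9 e)) 2,
      pol4 e (hess (tl9 e)) 0, zf e * pol4 e (tl9 e) 1, zf e * pol4 e (hess (tl9 e)) 3,
      pol6 e (sext (tl9 e)) 6, zf e * pol4 e (hess (tl9 e)) 1, pol6 e (sext (tl9 e)) 4,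
      pol6 e (sext (tl9 e)) 2, pol6 e (sext (tl9 e)) 0] := by
  have h1 : vd (hd (sqz e)) = 0 := by simp [vd, hd, sqz]; ring
  have h2 : vq (hd (sqz e)) = zf e ^ 2 := by simp [vq, hd, sqz, zf]; ring
  have h3 : tl (sqz e) = tl9 e := rfl
  simp only [gens, gen, h1, h2, h3, qgen_sqz, sgen_sqz]
  simp

theorem gens_sqz_one (e : Fin 9 → K) : gens (sqz e) 1 = qi (tl9 e) := by
  rw [gens_sqz]; rfl

theorem gens_sqz_two (e : Fin 9 → K) : gens (sqz e) 2 = qj (tl9 e) := by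
  rw [gens_sqz]; rfl

theorem gens_sqz_four (e : Fin 9 → K) : gens (sqz e) 4 = pol4 e (tl9 e) 4 := by
  rw [gens_sqz]; rfl

theorem gens_sqz_five (e : Fin 9 → K) : gens (sqz e) 5 = pol4 e (tl9 e) 2 := by
  rw [gens_sqz]; rfl

theorem gens_sqz_six (e : Fin 9 → K) : gens (sqz e) 6 = pol4 e (hess (tl9 e)) 4 := by
  rw [gens_sqz]; rfl

theorem gens_sqz_seven (e : Fin 9 → K) : gens (sqz e) 7 = pol4 e (tl9 e) 0 := by
  rw [gens_sqz]; rfl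

theorem gens_sqz_eight (e : Fin 9 → K) : gens (sqz e) 8 = zf e * pol4 e (tl9 e) 3 := by
  rw [gens_sqz]; rfl

theorem gens_sqz_nine (e : Fin 9 → K) : gens (sqz e) 9 = pol4 e (hess (tl9 e)) 2 := by
  rw [gens_sqz]; rfl

theorem gens_sqz_ten (e : Fin 9 → K) : gens (sqz e) 10 = pol4 e (hess (tl9 e)) 0 := by
  rw [gens_sqz]; rfl

theorem gens_sqz_eleven (e : Fin 9 → K) : gens (sqz e) 11 = zf e * pol4 e (tl9 e) 1 := by
  rw [gens_sqz]; rfl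

theorem gens_sqz_twelve (e : Fin 9 → K) : gens (sqz e) 12 = zf e * pol4 e (hess (tl9 e)) 3 := by
  rw [gens_sqz]; rfl

theorem gens_sqz_thirteen (e : Fin 9 → K) : gens (sqz e) 13 = pol6 e (sext (tl9 e)) 6 := by
  rw [gens_sqz]; rfl

theorem gens_sqz_fourteen (e : Fin 9 → K) : gens (sqz e) 14 = zf e * pol4 e (hess (tl9 e)) 1 := by
  rw [gens_sqz]; rfl

theorem gens_sqz_fifteen (e : Fin 9 → K) : gens (sqz e) 15 = pol6 e (sext (tl9 e)) 4 := by
  rw [gens_sqz]; rfl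

theorem gens_sqz_sixteen (e : Fin 9 → K) : gens (sqz e) 16 = pol6 e (sext (tl9 e)) 2 := by
  rw [gens_sqz]; rfl

theorem gens_sqz_seventeen (e : Fin 9 → K) : gens (sqz e) 17 = pol6 e (sext (tl9 e)) 0 := by
  rw [gens_sqz]; rfl

end NineFormulas
section Jac
variable {K : Type*} [CommRing K]

theorem pol6_one (e : Fin 9 → K) (a : Fin 5 → K) : zf e * pol6 e (sext a) 1
    = pol4 e a 0 * pol4 e (hess a) 2 - pol4 e a 2 * pol4 e (hess a) 0 := by
  simp [pol6, pol4, qact, sq, qua, cub, quad, lin, hess, sext, zf]; ring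

theorem pol6_three (e : Fin 9 → K) (a : Fin 5 → K) : 2 * (zf e * pol6 e (sext a) 3)
    = pol4 e a 0 * pol4 e (hess a) 4 - pol4 e a 4 * pol4 e (hess a) 0 := by
  simp [pol6, pol4, qact, sq, qua, cub, quad, lin, hess, sext, zf]; ring

theorem pol6_five (e : Fin 9 → K) (a : Fin 5 → K) : zf e * pol6 e (sext a) 5
    = pol4 e a 2 * pol4 e (hess a) 4 - pol4 e a 4 * pol4 e (hess a) 2 := by
  simp [pol6, pol4, qact, sq, qua, cub, quad, lin, hess, sext, zf]; ring

end Jac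

section MapNine

variable {K L : Type*} [CommRing K] [CommRing L] (φ : K →+* L)

theorem map_qact (p q r s : K) (a : Fin 5 → K) (k : Fin 5) :
    φ (qact p q r s a k) = qact (φ p) (φ q) (φ r) (φ s) (φ ∘ a) k := by
  fin_cases k <;> simp [qact, qua, cub, quad, lin]

theorem map_pol4 (e : Fin 9 → K) (a : Fin 5 → K) (k : Fin 5) :
    φ (pol4 e a k) = pol4 (φ ∘ e) (φ ∘ a) k := map_qact φ _ _ _ _ _ _

theorem map_pol6 (e : Fin 9 → K) (t : Fin 7 → K) (k : Fin 7) :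
    φ (pol6 e t k) = pol6 (φ ∘ e) (φ ∘ t) k := by
  fin_cases k <;> simp [pol6, map_pol4, map_sq]

theorem map_tl9 (e : Fin 9 → K) : φ ∘ tl9 e = tl9 (φ ∘ e) := by
  funext i; fin_cases i <;> rfl

theorem map_sqz (e : Fin 9 → K) : φ ∘ sqz e = sqz (φ ∘ e) := by
  funext i; fin_cases i <;> simp [sqz]

theorem map_act9 (p q r s : K) (e : Fin 9 → K) :
    φ ∘ act9 p q r s e = act9 (φ p) (φ q) (φ r) (φ s) (φ ∘ e) := by
  funext i; fin_cases i <;> simp [act9, map_qact, map_tl9]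

theorem map_zf (e : Fin 9 → K) : φ (zf e) = zf (φ ∘ e) := by simp [zf]

end MapNine

section ScaleNine

variable {K : Type*} [CommRing K]

/-- Rescaling of the two vectors. -/
def scale9 (s t : K) (e : Fin 9 → K) : Fin 9 → K :=
  ![s * e 0, s * e 1, t * e 2, t * e 3, e 4, e 5, e 6, e 7, e 8]

theorem pol4_scale (s t : K) (e : Fin 9 → K) (a : Fin 5 → K) (k : Fin 5) :
    pol4 (scale9 s t e) a k = s ^ (4 - (k : ℕ)) * t ^ (k : ℕ) * pol4 e a k := by
  fin_cases k <;> simp [pol4, scale9, qact, qua, cub, quad, lin] <;> ring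

theorem sq_scale (s x0 x1 : K) (t : Fin 7 → K) :
    sq (s * x0) (s * x1) t = fun k => s ^ 2 * sq x0 x1 t k := by
  funext k; fin_cases k <;> simp [sq, quad, lin] <;> ring

theorem pol4_smul (r : K) (e : Fin 9 → K) (a : Fin 5 → K) (k : Fin 5) :
    pol4 e (fun k => r * a k) k = r * pol4 e a k := by
  fin_cases k <;> simp [pol4, qact, qua, cub, quad, lin] <;> ring

theorem pol6_scale (s t : K) (e : Fin 9 → K) (a : Fin 7 → K) (k : Fin 7) :
    pol6 (scale9 s t e) a k = s ^ (6 - (k : ℕ)) * t ^ (k : ℕ) * pol6 e a k := by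
  have h0 : scale9 s t e 0 = s * e 0 := rfl
  have h1 : scale9 s t e 1 = s * e 1 := rfl
  have h2 : scale9 s t e 2 = t * e 2 := rfl
  have h3 : scale9 s t e 3 = t * e 3 := rfl
  fin_cases k <;>
    simp [pol6, h0, h1, h2, h3, sq_scale, pol4_smul, pol4_scale] <;> ring

end ScaleNine

theorem aeval_gens_sqz (e : Fin 9 → ℂ) (S : MvPolynomial (Fin 18) ℂ) :
    eval e (aeval (gens (sqz (X : Fin 9 → MvPolynomial (Fin 9) ℂ))) S)
      = eval (gens (sqz e)) S := by
  rw [eval_aeval]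
  congr 2
  funext k
  rw [map_gens, map_sqz, eval_comp_X]

/-- The restriction of the candidate algebra of invariants to pairs of vectors and a quartic. -/
def B9 : Subalgebra ℂ (MvPolynomial (Fin 9) ℂ) :=
  (aeval (gens (sqz (X : Fin 9 → MvPolynomial (Fin 9) ℂ)))).range

theorem gens_mem_B9 (k : Fin 18) :
    gens (sqz (X : Fin 9 → MvPolynomial (Fin 9) ℂ)) k ∈ B9 := ⟨X k, by simp⟩

/-- The bracket as a polynomial. -/
abbrev zP : MvPolynomial (Fin 9) ℂ := zf X

theorem eval_zP (e : Fin 9 → ℂ) : eval e zP = zf e := by rw [map_zf, eval_comp_X]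

theorem zP_ne_zero : zP ≠ 0 := by
  intro h
  have := congrArg (eval ![1, 0, 0, 1, 0, 0, 0, 0, 0]) h
  rw [eval_zP] at this
  simp [zf] at this

/-- Invariance under the action on triples (vector, vector, quartic). -/
def Inv9 (G : MvPolynomial (Fin 9) ℂ) : Prop :=
  ∀ p q r s : ℂ, p * s - q * r = 1 → ∀ e, eval (act9 p q r s e) G = eval e G

theorem inv9_of_mem_B9 {G : MvPolynomial (Fin 9) ℂ} (h : G ∈ B9) : Inv9 G := by
  obtain ⟨S, rfl⟩ := h
  intro p q r s hd e
  simp only [AlgHom.toRingHom_eq_coe, RingHom.coe_coe, aeval_gens_sqz]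
  rw [sqz_act9, gens_act hd]

theorem Inv9.of_mul {G : MvPolynomial (Fin 9) ℂ} (h : Inv9 (zP * G)) : Inv9 G := by
  intro p q r s hd e
  have e1 : ∀ e : Fin 9 → ℂ, eval e (aeval (act9 (C p) (C q) (C r) (C s) X) G)
      = eval (act9 p q r s e) G := by
    intro e
    rw [eval_aeval]
    congr 2
    have := map_act9 (eval e) (C p) (C q) (C r) (C s) X
    rw [eval_comp_X] at this
    simpa [funext_iff] using this
  have e2 : aeval (act9 (C p) (C q) (C r) (C s) X) G - G = 0 := by
    refine eval_eq_zero_of_mul zP_ne_zero fun e he => ?_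
    have := h p q r s hd e
    rw [map_mul, map_mul, eval_zP, eval_zP, zf_act9 hd] at this
    rw [eval_zP] at he
    rw [map_sub, e1, mul_left_cancel₀ he this, sub_self]
  rw [← e1, sub_eq_zero.1 e2]

/-- Weights of the first vector. -/
def wx : Fin 9 → ℕ := ![1, 1, 0, 0, 0, 0, 0, 0, 0]

/-- Weights of the second vector. -/
def wy : Fin 9 → ℕ := ![0, 0, 1, 1, 0, 0, 0, 0, 0]

/-- Bihomogeneous polynomials in the two vectors. -/
def BiHom (d e : ℕ) (G : MvPolynomial (Fin 9) ℂ) : Prop :=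
  IsWeightedHomogeneous wx G d ∧ IsWeightedHomogeneous wy G e

theorem BiHom.mul {d e d' e' : ℕ} {G H : MvPolynomial (Fin 9) ℂ} (h : BiHom d e G)
    (h' : BiHom d' e' H) : BiHom (d + d') (e + e') (G * H) := ⟨h.1.mul h'.1, h.2.mul h'.2⟩

theorem scale9_wx (s : ℂ) (e : Fin 9 → ℂ) : (fun i => s ^ wx i * e i) = scale9 s 1 e := by
  funext i; fin_cases i <;> simp [scale9, wx]

theorem scale9_wy (s : ℂ) (e : Fin 9 → ℂ) : (fun i => s ^ wy i * e i) = scale9 1 s e := by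
  funext i; fin_cases i <;> simp [scale9, wy]

theorem BiHom.eval_scale {d d' : ℕ} {G : MvPolynomial (Fin 9) ℂ} (h : BiHom d d' G) (s t : ℂ)
    (e : Fin 9 → ℂ) : eval (scale9 s t e) G = s ^ d * t ^ d' * eval e G := by
  have : scale9 s t e = scale9 s 1 (scale9 1 t e) := by
    funext i; fin_cases i <;> simp [scale9]
  rw [this, ← scale9_wx, eval_smul_of_isWeightedHomogeneous h.1, ← scale9_wy,
    eval_smul_of_isWeightedHomogeneous h.2, mul_assoc]

theorem bihom_of_eval {d d' : ℕ} {G : MvPolynomial (Fin 9) ℂ}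
    (h : ∀ s t e, eval (scale9 s t e) G = s ^ d * t ^ d' * eval e G) : BiHom d d' G :=
  ⟨isWeightedHomogeneous_of_eval fun s _ c => by rw [scale9_wx, h]; simp,
    isWeightedHomogeneous_of_eval fun s _ c => by rw [scale9_wy, h]; simp⟩

/-- The point where both vectors are the first basis vector. -/
def diag {K : Type*} [CommRing K] (a : Fin 5 → K) : Fin 9 → K :=
  ![1, 0, 1, 0, a 0, a 1, a 2, a 3, a 4]

theorem tl9_diag {K : Type*} [CommRing K] (a : Fin 5 → K) : tl9 (diag a) = a := fin5_eta a

theorem pol4_diag (e a : Fin 5 → ℂ) (k : Fin 5) : pol4 (diag e) a k = a 0 := by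
  fin_cases k <;> simp [pol4, diag, qact, qua, cub, quad, lin]

theorem pol6_diag (e : Fin 5 → ℂ) (t : Fin 7 → ℂ) (k : Fin 7) : pol6 (diag e) t k = t 0 := by
  have h0 : diag e 0 = 1 := rfl
  have h1 : diag e 1 = 0 := rfl
  have h2 : diag e 2 = 1 := rfl
  have h3 : diag e 3 = 0 := rfl
  fin_cases k <;> simp [pol6, h0, h1, h2, h3, pol4_diag, sq, quad, lin]

/-- Membership in `B9`, after multiplication with the bracket if the degree in `y` is odd. -/
def MemB (d : ℕ) (G : MvPolynomial (Fin 9) ℂ) : Prop :=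
  (Even d → G ∈ B9) ∧ (Odd d → zP * G ∈ B9)

theorem MemB.inv {d : ℕ} {G : MvPolynomial (Fin 9) ℂ} (h : MemB d G) : Inv9 G := by
  rcases Nat.even_or_odd d with hd | hd
  · exact inv9_of_mem_B9 (h.1 hd)
  · exact (inv9_of_mem_B9 (h.2 hd)).of_mul

theorem MemB.add {d : ℕ} {G H : MvPolynomial (Fin 9) ℂ} (h : MemB d G) (h' : MemB d H) :
    MemB d (G + H) :=
  ⟨fun hd => B9.add_mem (h.1 hd) (h'.1 hd),
    fun hd => by rw [mul_add]; exact B9.add_mem (h.2 hd) (h'.2 hd)⟩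

theorem MemB.mul {d d' : ℕ} {G H : MvPolynomial (Fin 9) ℂ} (h : MemB d G) (h' : MemB d' H)
    (hd : Even d ∨ Even d') : MemB (d + d') (G * H) := by
  rcases Nat.even_or_odd d with h1 | h1 <;> rcases Nat.even_or_odd d' with h2 | h2
  · exact ⟨fun _ => B9.mul_mem (h.1 h1) (h'.1 h2), fun h3 => absurd h3 (by simp [h1.add h2])⟩
  · refine ⟨fun h3 => absurd h3 (by simp [h1.add_odd h2]), fun _ => ?_⟩
    rw [mul_left_comm]
    exact B9.mul_mem (h.1 h1) (h'.2 h2)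
  · refine ⟨fun h3 => absurd h3 (by simp [h1.add_even h2]), fun _ => ?_⟩
    rw [← mul_assoc]
    exact B9.mul_mem (h.2 h1) (h'.1 h2)
  · rw [← Nat.not_even_iff_odd] at h1 h2
    exact absurd hd (by simp [h1, h2])

/-- `v` is the leading coefficient of members of `B9` (up to the bracket) of all bidegrees of total
degree `n`. -/
def Good (n : ℕ) (v : (Fin 5 → ℂ) → ℂ) : Prop :=
  ∀ d d', d + d' = n → ∃ E, BiHom d d' E ∧ MemB d' E ∧ ∀ a, eval (diag a) E = v a

theorem Good.add {n : ℕ} {v w : (Fin 5 → ℂ) → ℂ} (hv : Good n v) (hw : Good n w) :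
    Good n (fun a => v a + w a) := by
  intro d d' h
  obtain ⟨E, h1, h2, h3⟩ := hv d d' h
  obtain ⟨F, h4, h5, h6⟩ := hw d d' h
  exact ⟨E + F, ⟨h1.1.add h4.1, h1.2.add h4.2⟩, h2.add h5, fun a => by simp [h3, h6]⟩

theorem Good.mul {n m : ℕ} {v w : (Fin 5 → ℂ) → ℂ} (hn : Even n) (hv : Good n v)
    (hw : Good m w) : Good (n + m) (fun a => v a * w a) := by
  intro d d' h
  obtain ⟨E, h1, h2, h3⟩ := hv (n - min d' n) (min d' n) (by omega)
  obtain ⟨F, h4, h5, h6⟩ := hw (m - (d' - min d' n)) (d' - min d' n) (by omega)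
  have e1 : n - min d' n + (m - (d' - min d' n)) = d := by omega
  have e2 : min d' n + (d' - min d' n) = d' := by omega
  refine ⟨E * F, ?_, ?_, fun a => by simp [h3, h6]⟩
  · have := h1.mul h4
    rwa [e1, e2] at this
  · have := h2.mul h5 (by
      rcases le_total d' n with h | h
      · right; simp [h]
      · left; simpa [h] using hn)
    rwa [e2] at this

theorem good_const (r : ℂ) : Good 0 (fun _ => r) := by
  intro d d' h
  obtain ⟨rfl, rfl⟩ : d = 0 ∧ d' = 0 := by omega
  exact ⟨C r, ⟨isWeightedHomogeneous_C _ _, isWeightedHomogeneous_C _ _⟩,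
    ⟨fun _ => B9.algebraMap_mem r, fun h => absurd h (by simp)⟩, fun a => by simp⟩

theorem Good.pow {n : ℕ} {v : (Fin 5 → ℂ) → ℂ} (hn : Even n) (hv : Good n v) (k : ℕ) :
    Good (k * n) (fun a => v a ^ k) := by
  induction k with
  | zero => simpa using good_const 1
  | succ k ih =>
    have := ih.mul (hn.mul_left k) hv
    simpa [Nat.succ_mul, pow_succ] using this

/-- The quartic part of the generic point. -/
abbrev aX : Fin 5 → MvPolynomial (Fin 9) ℂ := tl9 X

theorem eval_comp_aX (e : Fin 9 → ℂ) : eval e ∘ aX = tl9 e := by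
  rw [map_tl9, eval_comp_X]

theorem eval_pol4 (e : Fin 9 → ℂ) (b : Fin 5 → MvPolynomial (Fin 9) ℂ) (k : Fin 5) :
    eval e (pol4 X b k) = pol4 e (eval e ∘ b) k := by rw [map_pol4, eval_comp_X]

theorem eval_pol6 (e : Fin 9 → ℂ) (b : Fin 7 → MvPolynomial (Fin 9) ℂ) (k : Fin 7) :
    eval e (pol6 X b k) = pol6 e (eval e ∘ b) k := by rw [map_pol6, eval_comp_X]

theorem good_pol4 {b : Fin 5 → MvPolynomial (Fin 9) ℂ}
    (hb : ∀ s t e, eval (scale9 s t e) ∘ b = eval e ∘ b)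
    (hB : ∀ k : Fin 5, MemB k (pol4 X b k)) : Good 4 (fun a => (eval (diag a) ∘ b) 0) := by
  intro d d' h
  refine ⟨pol4 X b ⟨d', by omega⟩, bihom_of_eval fun s t e => ?_, hB ⟨d', by omega⟩, fun a => ?_⟩
  · rw [eval_pol4, eval_pol4, hb, pol4_scale]
    obtain rfl : d = 4 - d' := by omega
    rfl
  · rw [eval_pol4, pol4_diag]

theorem good_pol6 {b : Fin 7 → MvPolynomial (Fin 9) ℂ}
    (hb : ∀ s t e, eval (scale9 s t e) ∘ b = eval e ∘ b)
    (hB : ∀ k : Fin 7, MemB k (pol6 X b k)) : Good 6 (fun a => (eval (diag a) ∘ b) 0) := by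
  intro d d' h
  refine ⟨pol6 X b ⟨d', by omega⟩, bihom_of_eval fun s t e => ?_, hB ⟨d', by omega⟩, fun a => ?_⟩
  · rw [eval_pol6, eval_pol6, hb, pol6_scale]
    obtain rfl : d = 6 - d' := by omega
    rfl
  · rw [eval_pol6, pol6_diag]

theorem memB_five {P : Fin 5 → MvPolynomial (Fin 9) ℂ} (h0 : P 0 ∈ B9) (h1 : zP * P 1 ∈ B9)
    (h2 : P 2 ∈ B9) (h3 : zP * P 3 ∈ B9) (h4 : P 4 ∈ B9) (k : Fin 5) : MemB k (P k) := by
  fin_cases k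
  · exact ⟨fun _ => h0, fun h => absurd h (by decide)⟩
  · exact ⟨fun h => absurd h (by decide), fun _ => h1⟩
  · exact ⟨fun _ => h2, fun h => absurd h (by decide)⟩
  · exact ⟨fun h => absurd h (by decide), fun _ => h3⟩
  · exact ⟨fun _ => h4, fun h => absurd h (by decide)⟩

theorem memB_seven {P : Fin 7 → MvPolynomial (Fin 9) ℂ} (h0 : P 0 ∈ B9) (h1 : zP * P 1 ∈ B9)
    (h2 : P 2 ∈ B9) (h3 : zP * P 3 ∈ B9) (h4 : P 4 ∈ B9) (h5 : zP * P 5 ∈ B9) (h6 : P 6 ∈ B9)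
    (k : Fin 7) : MemB k (P k) := by
  fin_cases k
  · exact ⟨fun _ => h0, fun h => absurd h (by decide)⟩
  · exact ⟨fun h => absurd h (by decide), fun _ => h1⟩
  · exact ⟨fun _ => h2, fun h => absurd h (by decide)⟩
  · exact ⟨fun h => absurd h (by decide), fun _ => h3⟩
  · exact ⟨fun _ => h4, fun h => absurd h (by decide)⟩
  · exact ⟨fun h => absurd h (by decide), fun _ => h5⟩
  · exact ⟨fun _ => h6, fun h => absurd h (by decide)⟩

theorem memB_pol4 (k : Fin 5) : MemB k (pol4 X aX k) :=
  memB_five (gens_sqz_seven (K := MvPolynomial (Fin 9) ℂ) X ▸ gens_mem_B9 7)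
    (gens_sqz_eleven (K := MvPolynomial (Fin 9) ℂ) X ▸ gens_mem_B9 11)
    (gens_sqz_five (K := MvPolynomial (Fin 9) ℂ) X ▸ gens_mem_B9 5)
    (gens_sqz_eight (K := MvPolynomial (Fin 9) ℂ) X ▸ gens_mem_B9 8)
    (gens_sqz_four (K := MvPolynomial (Fin 9) ℂ) X ▸ gens_mem_B9 4) k

theorem memB_pol4_hess (k : Fin 5) : MemB k (pol4 X (hess aX) k) :=
  memB_five (gens_sqz_ten (K := MvPolynomial (Fin 9) ℂ) X ▸ gens_mem_B9 10)
    (gens_sqz_fourteen (K := MvPolynomial (Fin 9) ℂ) X ▸ gens_mem_B9 14)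
    (gens_sqz_nine (K := MvPolynomial (Fin 9) ℂ) X ▸ gens_mem_B9 9)
    (gens_sqz_twelve (K := MvPolynomial (Fin 9) ℂ) X ▸ gens_mem_B9 12)
    (gens_sqz_six (K := MvPolynomial (Fin 9) ℂ) X ▸ gens_mem_B9 6) k

theorem jac_mem {i j : Fin 5} (hi : Even (i : ℕ)) (hj : Even (j : ℕ)) :
    pol4 X aX i * pol4 X (hess aX) j - pol4 X aX j * pol4 X (hess aX) i ∈ B9 :=
  B9.sub_mem (B9.mul_mem ((memB_pol4 i).1 hi) ((memB_pol4_hess j).1 hj))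
    (B9.mul_mem ((memB_pol4 j).1 hj) ((memB_pol4_hess i).1 hi))

theorem memB_pol6_sext (k : Fin 7) : MemB k (pol6 X (sext aX) k) := by
  refine memB_seven (gens_sqz_seventeen (K := MvPolynomial (Fin 9) ℂ) X ▸ gens_mem_B9 17) ?_
    (gens_sqz_sixteen (K := MvPolynomial (Fin 9) ℂ) X ▸ gens_mem_B9 16) ?_
    (gens_sqz_fifteen (K := MvPolynomial (Fin 9) ℂ) X ▸ gens_mem_B9 15) ?_
    (gens_sqz_thirteen (K := MvPolynomial (Fin 9) ℂ) X ▸ gens_mem_B9 13) k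
  · rw [pol6_one]; exact jac_mem (by decide) (by decide)
  · have h1 : 2 * (zP * pol6 X (sext aX) 3) ∈ B9 := by
      rw [pol6_three]; exact jac_mem (by decide) (by decide)
    have h2 := B9.smul_mem h1 (1 / 2)
    convert h2 using 1
    rw [two_mul, smul_add, ← add_smul]; norm_num
  · rw [pol6_five]; exact jac_mem (by decide) (by decide)

/-- Weights of the leading coefficients of covariants. -/
def wcov : Fin 5 → ℕ := ![4, 4, 6, 0, 0]

theorem good_zero_of_mem {v : (Fin 5 → ℂ) → ℂ} {E : MvPolynomial (Fin 9) ℂ} (hE : E ∈ B9)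
    (h : ∀ e, eval e E = v (tl9 e)) : Good 0 v := by
  intro d d' hdd
  obtain ⟨rfl, rfl⟩ : d = 0 ∧ d' = 0 := by omega
  refine ⟨E, bihom_of_eval fun s t e => ?_, ⟨fun _ => hE, fun h => absurd h (by simp)⟩,
    fun a => ?_⟩
  · rw [h, h, pow_zero, pow_zero, one_mul, one_mul]; rfl
  · rw [h, tl9_diag]

theorem good_cov (i : Fin 5) : Good (wcov i) (fun a => cov a i) := by
  have hs : ∀ s t e, eval (scale9 s t e) ∘ aX = eval e ∘ aX := fun s t e => by
    rw [eval_comp_aX, eval_comp_aX]; rfl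
  have hd : ∀ a, eval (diag a) ∘ aX = a := fun a => by rw [eval_comp_aX, tl9_diag]
  have h0 : Good 4 fun a => a 0 := by simpa only [hd] using good_pol4 hs memB_pol4
  have h1 : Good 4 fun a => hess a 0 := by
    simpa only [map_hess, hd] using good_pol4 (b := hess aX)
      (fun s t e => by simp only [map_hess, hs]) memB_pol4_hess
  have h2 : Good 6 fun a => sext a 0 := by
    simpa only [map_sext, hd] using good_pol6 (b := sext aX)
      (fun s t e => by simp only [map_sext, hs]) memB_pol6_sext
  have h3 : Good 0 fun a => qi a := good_zero_of_mem
    (gens_sqz_one (K := MvPolynomial (Fin 9) ℂ) X ▸ gens_mem_B9 1)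
    fun e => by rw [← eval_comp_aX]; simp [qi, map_ofNat]
  have h4 : Good 0 fun a => qj a := good_zero_of_mem
    (gens_sqz_two (K := MvPolynomial (Fin 9) ℂ) X ▸ gens_mem_B9 2)
    fun e => by rw [← eval_comp_aX]; simp [qj, map_ofNat]
  fin_cases i
  exacts [h0, h1, h2, h3, h4]

theorem even_wcov (i : Fin 5) : Even (wcov i) := by fin_cases i <;> decide

theorem good_eval_cov {n : ℕ} {S : MvPolynomial (Fin 5) ℂ} (h : IsWeightedHomogeneous wcov S n) :
    Good n (fun a => eval (cov a) S) := by
  induction h using IsWeightedHomogeneous.induction_on with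
  | zero =>
    intro d d' _
    exact ⟨0, ⟨isWeightedHomogeneous_zero _ _ _, isWeightedHomogeneous_zero _ _ _⟩,
      ⟨fun _ => B9.zero_mem, fun _ => by rw [mul_zero]; exact B9.zero_mem⟩, fun a => by simp⟩
  | add p q _ _ hp hq => simpa using hp.add hq
  | monomial d r hr =>
    have key : ∀ i, Good (d i * wcov i) (fun a => cov a i ^ d i) := fun i =>
      (good_cov i).pow (even_wcov i) _
    have ev : ∀ i, Even (d i * wcov i) := fun i => (even_wcov i).mul_left _
    have h1 := (key 0).mul (ev 0) (key 1)
    have h2 := h1.mul ((ev 0).add (ev 1)) (key 2)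
    have h3 := h2.mul (((ev 0).add (ev 1)).add (ev 2)) (key 3)
    have h4 := h3.mul ((((ev 0).add (ev 1)).add (ev 2)).add (ev 3)) (key 4)
    have h5 := (good_const r).mul (by simp) h4
    have e : 0 + (d 0 * wcov 0 + d 1 * wcov 1 + d 2 * wcov 2 + d 3 * wcov 3 + d 4 * wcov 4) = n := by
      rw [← hr, Finsupp.weight_apply, Finsupp.sum_fintype _ _ (by simp)]
      simp [Fin.sum_univ_succ]; ring
    rw [e] at h5
    convert h5 using 2 with a
    rw [eval_monomial, Finsupp.prod_fintype _ _ (by simp)]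
    simp only [Fin.prod_univ_succ, Fin.prod_univ_zero, mul_one, mul_assoc]; rfl

theorem zP_irreducible : Irreducible zP := by
  have h : zP = (X 0 : MvPolynomial (Fin 9) ℂ) * X 3 + -(X 1 * X 2) := by
    simp only [zP, zf]; ring
  rw [h]
  refine irreducible_mul_X_add _ _ 3 (X_ne_zero 0) (by simp) ?_ ?_
  · rw [MvPolynomial.vars_neg]
    intro h3
    have := vars_mul _ _ h3
    simp at this
  · rw [IsRelPrime.neg_right_iff]
    refine IsRelPrime.mul_right ?_ ?_ <;>
      rw [MvPolynomial.X_prime.irreducible.isRelPrime_iff_not_dvd, X_dvd_X] <;> simp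

theorem isWeightedHomogeneous_component {σ : Type*} (w : σ → ℕ) (k : ℕ) (P : MvPolynomial σ ℂ) :
    IsWeightedHomogeneous w (weightedHomogeneousComponent w k P) k :=
  weightedHomogeneousComponent_mem w P k

theorem isWeightedHomogeneous_of_mul {σ : Type*} [Finite σ] {w : σ → ℕ} {P q : MvPolynomial σ ℂ}
    {m n : ℕ} (hq0 : q ≠ 0) (hq : IsWeightedHomogeneous w q m)
    (h : IsWeightedHomogeneous w (q * P) n) :
    P = 0 ∨ ∃ k, k + m = n ∧ IsWeightedHomogeneous w P k := by
  by_cases hmn : m ≤ n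
  · right
    refine ⟨n - m, by omega, ?_⟩
    have hz : ∀ k, k ≠ n - m → weightedHomogeneousComponent w k P = 0 := fun k hk =>
      component_eq_zero_of_mul hq0 hq h (by omega)
    obtain ⟨N, hN⟩ := sum_component w P
    rw [hN]
    refine IsWeightedHomogeneous.sum _ _ _ fun k _ => ?_
    by_cases hk : k = n - m
    · rw [← hk]; exact isWeightedHomogeneous_component _ _ _
    · rw [hz k hk]; exact isWeightedHomogeneous_zero _ _ _
  · left
    obtain ⟨N, hN⟩ := sum_component w P
    rw [hN]
    exact Finset.sum_eq_zero fun k _ => component_eq_zero_of_mul hq0 hq h (by omega)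

theorem zP_bihom : BiHom 1 1 zP :=
  bihom_of_eval fun s t e => by rw [eval_zP, eval_zP]; simp [zf, scale9]; ring

theorem zP_sq_mem : zP * zP ∈ B9 := by
  have := gens_mem_B9 3
  rw [gens_sqz] at this
  simpa [pow_two] using this

theorem act9_scale9 {K : Type*} [CommRing K] (p q r s l m : K) (e : Fin 9 → K) :
    act9 p q r s (scale9 l m e) = scale9 l m (act9 p q r s e) := by
  have h : tl9 (scale9 l m e) = tl9 e := rfl
  funext i
  fin_cases i <;> simp only [act9, h] <;> simp [scale9] <;> ring

theorem Inv9.component_wx {G : MvPolynomial (Fin 9) ℂ} (h : Inv9 G) (k : ℕ) :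
    Inv9 (weightedHomogeneousComponent wx k G) := fun p q r s hd e =>
  eval_component_eq (fun t _ => by rw [scale9_wx, scale9_wx, ← act9_scale9, h p q r s hd]) k

theorem Inv9.component_wy {G : MvPolynomial (Fin 9) ℂ} (h : Inv9 G) (k : ℕ) :
    Inv9 (weightedHomogeneousComponent wy k G) := fun p q r s hd e =>
  eval_component_eq (fun t _ => by rw [scale9_wy, scale9_wy, ← act9_scale9, h p q r s hd]) k

theorem component_wy_wx {G : MvPolynomial (Fin 9) ℂ} {d : ℕ} (h : IsWeightedHomogeneous wx G d)
    (k : ℕ) : BiHom d k (weightedHomogeneousComponent wy k G) := by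
  refine ⟨isWeightedHomogeneous_of_eval fun s hs c => ?_,
    isWeightedHomogeneous_component wy k G⟩
  have : s ^ d * eval c (weightedHomogeneousComponent wy k G)
      = eval c (weightedHomogeneousComponent wy k (C (s ^ d) * G)) := by
    rw [← smul_eq_C_mul, map_smul, smul_eval]
  rw [this]
  refine eval_component_eq (fun t _ => ?_) k
  rw [scale9_wy, map_mul, eval_C, scale9_wy, ← eval_smul_of_isWeightedHomogeneous h,
    scale9_wx, scale9_wx]
  congr 2
  funext i; fin_cases i <;> simp [scale9]

theorem act9_upper_diag (u : ℂ) (a : Fin 5 → ℂ) :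
    act9 1 u 0 1 (diag a) = diag (qact 1 u 0 1 a) := by
  have h : tl9 (diag a) = a := tl9_diag a
  funext i
  fin_cases i <;> simp only [act9, h] <;> simp [diag]

theorem act9_torus_diag {l : ℂ} (a : Fin 5 → ℂ) :
    act9 l 0 0 l⁻¹ (diag a) = scale9 l⁻¹ l⁻¹ (diag (qact l 0 0 l⁻¹ a)) := by
  have h : tl9 (diag a) = a := tl9_diag a
  funext i
  fin_cases i <;> simp only [act9, h] <;> simp [diag, scale9]

theorem cov_torus {l : ℂ} (hl : l ≠ 0) (a : Fin 5 → ℂ) (i : Fin 5) :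
    cov (qact l 0 0 l⁻¹ a) i = l ^ wcov i * cov a i := by
  have e : qact l 0 0 l⁻¹ a = ![l ^ 4 * a 0, l ^ 2 * a 1, a 2, (l ^ 2)⁻¹ * a 3, (l ^ 4)⁻¹ * a 4] := by
    funext k
    fin_cases k <;> simp [qact, qua, cub, quad, lin] <;> field_simp
  rw [e]
  fin_cases i <;> simp [cov, hess, sext, qi, qj, wcov] <;> field_simp

theorem Inv9.exists_cov {G : MvPolynomial (Fin 9) ℂ} {d d' : ℕ} (h : Inv9 G) (hb : BiHom d d' G) :
    ∃ S, IsWeightedHomogeneous wcov S (d + d') ∧ ∀ a, eval (diag a) G = eval (cov a) S := by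
  have hp : ∀ a, eval a (aeval (diag (X : Fin 5 → MvPolynomial (Fin 5) ℂ)) G) = eval (diag a) G := by
    intro a
    rw [eval_aeval]
    congr 2
    funext i; fin_cases i <;> simp [diag]
  obtain ⟨S, hS⟩ := BinInv.exists_cov (p := aeval (diag (X : Fin 5 → MvPolynomial (Fin 5) ℂ)) G)
    fun u a => by rw [hp, hp, ← act9_upper_diag, h _ _ _ _ (by simp)]
  simp only [hp] at hS
  refine ⟨weightedHomogeneousComponent wcov (d + d') S,
    isWeightedHomogeneous_component _ _ _, fun a => ?_⟩
  refine (eval_component_of_scaling fun l hl => ?_).symm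
  have e : (fun i => l ^ wcov i * cov a i) = cov (qact l 0 0 l⁻¹ a) :=
    funext fun i => (cov_torus hl a i).symm
  rw [e, ← hS]
  have := h l 0 0 l⁻¹ (by simp [hl]) (diag a)
  rw [act9_torus_diag, hb.eval_scale] at this
  have e2 : l ^ (d + d') * (l⁻¹ ^ d * l⁻¹ ^ d') = 1 := by
    rw [← pow_add, ← mul_pow, mul_inv_cancel₀ hl, one_pow]
  rw [← this, ← mul_assoc, e2, one_mul]

/-- Two parallel vectors can be moved to a diagonal point. -/
theorem Inv9.vanish {W : MvPolynomial (Fin 9) ℂ} {d d' : ℕ} (h : Inv9 W) (hb : BiHom d d' W)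
    (h0 : ∀ a, eval (diag a) W = 0) (e : Fin 9 → ℂ) (he : zf e = 0) : eval e W = 0 := by
  have key : ∀ (v0 v1 : ℂ) (a : Fin 5 → ℂ), ¬ (v0 = 0 ∧ v1 = 0) →
      eval ![v0, v1, v0, v1, a 0, a 1, a 2, a 3, a 4] W = 0 := by
    intro v0 v1 a hv
    have t : tl9 ![v0, v1, v0, v1, a 0, a 1, a 2, a 3, a 4] = a := fin5_eta a
    by_cases hv0 : v0 = 0
    · have hv1 : v1 ≠ 0 := fun h => hv ⟨hv0, h⟩
      rw [← h 0 (-v1⁻¹) v1 0 (by simp [hv1])]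
      refine Eq.trans ?_ (h0 (qact 0 (-v1⁻¹) v1 0 a))
      congr 2
      funext i
      fin_cases i <;> simp only [act9, t] <;> simp [diag, hv0, hv1]
    · rw [← h v0 0 v1 v0⁻¹ (by simp [hv0])]
      refine Eq.trans ?_ (h0 (qact v0 0 v1 v0⁻¹ a))
      congr 2
      funext i
      fin_cases i <;> simp only [act9, t] <;> simp [diag, hv0] <;> ring
  have key2 : ∀ v0 v1 l m : ℂ, ¬ (v0 = 0 ∧ v1 = 0) → e 0 = l * v0 → e 1 = l * v1 →
      e 2 = m * v0 → e 3 = m * v1 → eval e W = 0 := by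
    intro v0 v1 l m hv e0 e1 e2 e3
    have := hb.eval_scale l m ![v0, v1, v0, v1, e 4, e 5, e 6, e 7, e 8]
    rw [show (![v0, v1, v0, v1, e 4, e 5, e 6, e 7, e 8] : Fin 9 → ℂ)
      = ![v0, v1, v0, v1, tl9 e 0, tl9 e 1, tl9 e 2, tl9 e 3, tl9 e 4] from rfl, key _ _ _ hv,
      mul_zero] at this
    rw [← this]
    congr 2
    funext i; fin_cases i <;> simp [scale9, tl9, e0, e1, e2, e3]
  simp only [zf] at he
  by_cases hx : e 0 = 0 ∧ e 1 = 0
  · by_cases hy : e 2 = 0 ∧ e 3 = 0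
    · exact key2 1 0 0 0 (by simp) (by simp [hx]) (by simp [hx]) (by simp [hy]) (by simp [hy])
    · exact key2 (e 2) (e 3) 0 1 hy (by simp [hx]) (by simp [hx]) (by simp) (by simp)
  · by_cases hx0 : e 0 = 0
    · have hx1 : e 1 ≠ 0 := fun h => hx ⟨hx0, h⟩
      refine key2 (e 0) (e 1) 1 (e 3 / e 1) hx (by simp) (by simp) ?_ (by field_simp)
      field_simp; linear_combination -he
    · refine key2 (e 0) (e 1) 1 (e 2 / e 0) hx (by simp) (by simp) (by field_simp) ?_
      field_simp; linear_combination he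

theorem MemB.zP_mul {d : ℕ} {G : MvPolynomial (Fin 9) ℂ} (h : MemB d G) : MemB (d + 1) (zP * G) := by
  refine ⟨fun hd => h.2 (by by_contra h'; simp at h'; exact absurd hd (by simp [h'])), fun hd => ?_⟩
  rw [← mul_assoc]
  exact B9.mul_mem zP_sq_mem (h.1 (by by_contra h'; simp at h'; exact absurd hd (by simp [h'])))

theorem Inv9.memB (d : ℕ) : ∀ {d' : ℕ} {G : MvPolynomial (Fin 9) ℂ}, Inv9 G → BiHom d d' G →
    MemB d' G := by
  induction d using Nat.strong_induction_on with
  | _ d ih =>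
  intro d' G hG hb
  obtain ⟨S, hS, hGS⟩ := hG.exists_cov hb
  obtain ⟨E, hE, hEB, hES⟩ := good_eval_cov hS d d' rfl
  have hW : Inv9 (G - E) := fun p q r s hd e => by
    rw [map_sub, map_sub, hG _ _ _ _ hd, hEB.inv _ _ _ _ hd]
  have hWb : BiHom d d' (G - E) := bihom_of_eval fun s t e => by
    rw [map_sub, map_sub, hb.eval_scale, hE.eval_scale]; ring
  obtain ⟨W, hWW⟩ := dvd_of_vanish zP_irreducible fun e he =>
    hW.vanish hWb (fun a => by rw [map_sub, hGS, hES, sub_self]) e (by rwa [eval_zP] at he)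
  rw [hWW] at hW hWb
  have hW' := hW.of_mul
  suffices MemB d' (zP * W) by
    have h2 := hEB.add this
    rwa [← hWW, add_sub_cancel] at h2
  rcases isWeightedHomogeneous_of_mul zP_ne_zero zP_bihom.1 hWb.1 with rfl | ⟨k, rfl, hk⟩
  · exact ⟨fun _ => by rw [mul_zero]; exact B9.zero_mem,
      fun _ => by rw [mul_zero, mul_zero]; exact B9.zero_mem⟩
  rcases isWeightedHomogeneous_of_mul zP_ne_zero zP_bihom.2 hWb.2 with rfl | ⟨l, rfl, hl⟩
  · exact ⟨fun _ => by rw [mul_zero]; exact B9.zero_mem,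
      fun _ => by rw [mul_zero, mul_zero]; exact B9.zero_mem⟩
  exact (ih k (by omega) hW' ⟨hk, hl⟩).zP_mul

/-- Invariants of triples (vector, vector, quartic) that are even in the second vector. -/
theorem Inv9.mem_B9 {G : MvPolynomial (Fin 9) ℂ} (hG : Inv9 G)
    (he : ∀ e, eval (scale9 1 (-1) e) G = eval e G) : G ∈ B9 := by
  obtain ⟨N, hN⟩ := sum_component wx G
  rw [hN]
  refine B9.sum_mem fun k _ => ?_
  have hk := isWeightedHomogeneous_component wx k G
  obtain ⟨M, hM⟩ := sum_component wy (weightedHomogeneousComponent wx k G)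
  rw [hM]
  refine B9.sum_mem fun l _ => ?_
  have hb := component_wy_wx hk l
  have hi := (hG.component_wx k).component_wy l
  rcases Nat.even_or_odd l with hl | hl
  · exact (hi.memB k hb).1 hl
  · have ev : ∀ e, eval (scale9 1 (-1) e) (weightedHomogeneousComponent wy l
        (weightedHomogeneousComponent wx k G)) = eval e (weightedHomogeneousComponent wy l
        (weightedHomogeneousComponent wx k G)) := by
      have comm : ∀ s t s' t' (e : Fin 9 → ℂ), scale9 s t (scale9 s' t' e)
          = scale9 s' t' (scale9 s t e) := by
        intro s t s' t' e; funext i; fin_cases i <;> simp [scale9] <;> ring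
      intro e
      refine eval_component_eq (fun t _ => ?_) l
      rw [scale9_wy, scale9_wy]
      refine eval_component_eq (fun t' _ => ?_) k
      rw [scale9_wx, scale9_wx, comm 1 t, comm t' 1, he]
    have : weightedHomogeneousComponent wy l (weightedHomogeneousComponent wx k G) = 0 := by
      apply MvPolynomial.funext
      intro e
      have := ev e
      rw [hb.eval_scale, hl.neg_one_pow] at this
      rw [map_zero]
      linear_combination (-1 / 2) * this
    rw [this]
    exact B9.zero_mem

section Scale

variable {K : Type*} [CommRing K]

/-- Rescaling of the vector, the bivector and the quartic. -/
def scale10 (s t u : K) (c : Fin 10 → K) : Fin 10 → K :=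
  ![s * c 0, s * c 1, t * c 2, t * c 3, t * c 4, u * c 5, u * c 6, u * c 7, u * c 8, u * c 9]

/-- Degrees of the generators in the vector. -/
def degX : Fin 18 → ℕ := ![0, 0, 0, 2, 0, 2, 0, 4, 2, 2, 4, 4, 2, 0, 4, 2, 4, 6]

/-- Degrees of the generators in the bivector. -/
def degW : Fin 18 → ℕ := ![2, 0, 0, 1, 2, 1, 2, 0, 2, 1, 0, 1, 2, 3, 1, 2, 1, 0]

/-- Degrees of the generators in the quartic. -/
def degA : Fin 18 → ℕ := ![0, 2, 3, 0, 1, 1, 2, 1, 1, 2, 2, 1, 2, 3, 2, 3, 3, 3]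

/-- Total degrees of the generators. -/
def degT : Fin 18 → ℕ := ![2, 2, 3, 3, 3, 4, 4, 5, 5, 5, 6, 6, 6, 6, 7, 7, 8, 9]

theorem degT_eq (k : Fin 18) : degT k = degX k + degW k + degA k := by
  fin_cases k <;> rfl

theorem tl_scale10 (s t u : K) (c : Fin 10 → K) : tl (scale10 s t u c) = fun k => u * tl c k := by
  funext k; fin_cases k <;> rfl

/-- Rescaling of the vector and the bivector. -/
def scale5 (s t : K) (v : Fin 5 → K) : Fin 5 → K := ![s * v 0, s * v 1, t * v 2, t * v 3, t * v 4]

theorem hd_scale10 (s t u : K) (c : Fin 10 → K) : hd (scale10 s t u c) = scale5 s t (hd c) := by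
  funext k; fin_cases k <;> rfl

theorem act_smul (p q r s t : K) (c : Fin 10 → K) :
    act p q r s (fun i => t * c i) = fun i => t * act p q r s c i := by
  funext i
  fin_cases i <;> simp [act, mk, vact, qact, hd, tl, qua, cub, quad, lin] <;> ring

theorem qgen_scale5 (s t u : K) (v a : Fin 5 → K) (k : Fin 5) :
    qgen (scale5 s t v) (fun k => u * a k) k
      = s ^ (![4, 4, 2, 2, 0] : Fin 5 → ℕ) k * t ^ (![0, 1, 1, 2, 2] : Fin 5 → ℕ) k * u
        * qgen v a k := by
  fin_cases k <;> simp [qgen, scale5, qua, cub, quad, lin, cw] <;> ring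

theorem hess_smul (u : K) (a : Fin 5 → K) : hess (fun k => u * a k) = fun k => u ^ 2 * hess a k := by
  funext k; fin_cases k <;> simp [hess] <;> ring

theorem sext_smul (u : K) (a : Fin 5 → K) : sext (fun k => u * a k) = fun k => u ^ 3 * sext a k := by
  funext k; fin_cases k <;> simp [sext] <;> ring

theorem sq_smul (s x0 x1 u : K) (a : Fin 7 → K) :
    sq (s * x0) (s * x1) (fun k => u * a k) = fun k => (s ^ 2 * u) * sq x0 x1 a k := by
  funext k; fin_cases k <;> simp [sq, quad, lin] <;> ring

theorem sgen_scale5 (s t u : K) (v : Fin 5 → K) (a : Fin 7 → K) (k : Fin 4) :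
    sgen (scale5 s t v) (fun k => u * a k) k
      = s ^ (![6, 4, 2, 0] : Fin 4 → ℕ) k * t ^ (![0, 1, 2, 3] : Fin 4 → ℕ) k * u
        * sgen v a k := by
  have h0 : scale5 s t v 0 = s * v 0 := rfl
  have h1 : scale5 s t v 1 = s * v 1 := rfl
  have h2 : scale5 s t v 2 = t * v 2 := rfl
  have h3 : scale5 s t v 3 = t * v 3 := rfl
  have h4 : scale5 s t v 4 = t * v 4 := rfl
  fin_cases k <;> simp [sgen, h0, h1, sq_smul, qgen_scale5, h2, h3, h4] <;> ring

theorem gens_scale10 (s t u : K) (c : Fin 10 → K) (k : Fin 18) :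
    gens (scale10 s t u c) k = s ^ degX k * t ^ degW k * u ^ degA k * gens c k := by
  rw [gens, gens, hd_scale10, tl_scale10]
  generalize hd c = v
  generalize tl c = a
  fin_cases k <;>
    simp [gen, hess_smul, sext_smul, qgen_scale5, sgen_scale5, degX, degW, degA] <;>
    simp [vd, vq, qi, qj, scale5] <;> ring

theorem gens_smul (s : K) (c : Fin 10 → K) (k : Fin 18) :
    gens (fun i => s * c i) k = s ^ degT k * gens c k := by
  have : (fun i => s * c i) = scale10 s s s c := by funext i; fin_cases i <;> rfl
  rw [this, gens_scale10, degT_eq, pow_add, pow_add]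

end Scale

theorem eval_aeval_gens (c : Fin 10 → ℂ) (S : MvPolynomial (Fin 18) ℂ) :
    eval c (aeval (gens (X : Fin 10 → MvPolynomial (Fin 10) ℂ)) S) = eval (gens c) S := by
  rw [eval_aeval]
  congr 2
  funext k
  rw [map_gens, eval_comp_X]

/-- The discriminant of the bivector as a polynomial. -/
abbrev dP : MvPolynomial (Fin 10) ℂ := gens X 0

theorem eval_dP (c : Fin 10 → ℂ) : eval c dP = vd (hd c) := by
  rw [map_gens, eval_comp_X]; rfl

theorem dP_irreducible : Irreducible dP := by
  have h : dP = (X 2 : MvPolynomial (Fin 10) ℂ) * X 4 + -(X 3 * X 3) := by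
    have : dP = vd (hd X) := rfl
    rw [this]
    simp [vd, hd]; ring
  rw [h]
  refine irreducible_mul_X_add _ _ 4 (X_ne_zero 2) (by simp) ?_ ?_
  · rw [MvPolynomial.vars_neg]
    intro h3
    have := vars_mul _ _ h3
    simp at this
  · rw [IsRelPrime.neg_right_iff]
    refine IsRelPrime.mul_right ?_ ?_ <;>
      rw [MvPolynomial.X_prime.irreducible.isRelPrime_iff_not_dvd, X_dvd_X] <;> simp

/-- Invariance under the action on triples (vector, bivector, quartic). -/
def Inv10 (F : MvPolynomial (Fin 10) ℂ) : Prop :=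
  ∀ p q r s : ℂ, p * s - q * r = 1 → ∀ c, eval (act p q r s c) F = eval c F

theorem inv10_aeval_gens (S : MvPolynomial (Fin 18) ℂ) : Inv10 (aeval (gens X) S) :=
  fun p q r s hd c => by rw [eval_aeval_gens, eval_aeval_gens, gens_act hd]

theorem map_vact {K L : Type*} [CommRing K] [CommRing L] (φ : K →+* L) (p q r s : K)
    (v : Fin 5 → K) : φ ∘ vact p q r s v = vact (φ p) (φ q) (φ r) (φ s) (φ ∘ v) := by
  funext i; fin_cases i <;> simp [vact, map_ofNat]

theorem map_act {K L : Type*} [CommRing K] [CommRing L] (φ : K →+* L) (p q r s : K)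
    (c : Fin 10 → K) : φ ∘ act p q r s c = act (φ p) (φ q) (φ r) (φ s) (φ ∘ c) := by
  rw [act, map_mk, map_vact, map_hd, act, ← map_tl]
  congr 1
  funext k
  exact map_qact φ p q r s _ k

theorem Inv10.of_mul {F : MvPolynomial (Fin 10) ℂ} (h : Inv10 (dP * F)) : Inv10 F := by
  intro p q r s hd c
  have e1 : ∀ c : Fin 10 → ℂ, eval c (aeval (act (C p) (C q) (C r) (C s) X) F)
      = eval (act p q r s c) F := by
    intro c
    rw [eval_aeval]
    congr 2
    have := map_act (eval c) (C p) (C q) (C r) (C s) X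
    rw [eval_comp_X] at this
    simpa [funext_iff] using this
  have e2 : aeval (act (C p) (C q) (C r) (C s) X) F - F = 0 := by
    refine eval_eq_zero_of_mul dP_irreducible.ne_zero fun c hc => ?_
    have := h p q r s hd c
    have hD : eval (act p q r s c) dP = eval c dP := by
      rw [map_gens, map_gens, eval_comp_X, eval_comp_X, gens_act hd]
    rw [map_mul, map_mul, hD] at this
    rw [map_sub, e1, mul_left_cancel₀ hc this, sub_self]
  rw [← e1, sub_eq_zero.1 e2]

theorem exists_sqz {c : Fin 10 → ℂ} (h : vd (hd c) = 0) : ∃ e, sqz e = c := by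
  have hc : c 2 * c 4 - c 3 ^ 2 = 0 := h
  obtain ⟨y, hy⟩ := IsAlgClosed.exists_pow_nat_eq (c 2) (n := 2) (by norm_num)
  by_cases hy0 : y = 0
  · obtain ⟨z, hz⟩ := IsAlgClosed.exists_pow_nat_eq (c 4) (n := 2) (by norm_num)
    have h2 : c 2 = 0 := by rw [← hy, hy0]; simp
    have h3 : c 3 = 0 := by simpa [h2] using hc
    refine ⟨![c 0, c 1, 0, z, c 5, c 6, c 7, c 8, c 9], ?_⟩
    funext i; fin_cases i <;> simp [sqz, h2, h3, hz]
  · refine ⟨![c 0, c 1, y, c 3 / y, c 5, c 6, c 7, c 8, c 9], ?_⟩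
    have h4 : (c 3 / y) ^ 2 = c 4 := by
      field_simp; rw [hy]; linear_combination -hc
    funext i; fin_cases i <;> simp [sqz, hy, h4]
    field_simp

theorem isWeightedHomogeneous_dP : IsWeightedHomogeneous (fun _ => 1) dP 2 :=
  isWeightedHomogeneous_of_eval fun s _ c => by
    simp only [pow_one]
    rw [map_gens, map_gens, eval_comp_X, eval_comp_X, gens_smul]; rfl

/-- Invariants restricted to degenerate bivectors come from the generators. -/
theorem Inv10.exists_restriction {F : MvPolynomial (Fin 10) ℂ} {n : ℕ} (hF : Inv10 F)
    (hn : IsWeightedHomogeneous (fun _ => 1) F n) :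
    ∃ S, IsWeightedHomogeneous degT S n ∧ ∀ c, vd (hd c) = 0 → eval c F = eval (gens c) S := by
  have hG : ∀ e, eval e (aeval (sqz (X : Fin 9 → MvPolynomial (Fin 9) ℂ)) F)
      = eval (sqz e) F := by
    intro e
    rw [eval_aeval]
    congr 2
    have := map_sqz (eval e) X
    rw [eval_comp_X] at this
    simpa [funext_iff] using this
  have hmem : aeval (sqz (X : Fin 9 → MvPolynomial (Fin 9) ℂ)) F ∈ B9 := by
    refine Inv9.mem_B9 (fun p q r s hd e => ?_) fun e => ?_
    · rw [hG, hG, sqz_act9, hF p q r s hd]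
    · rw [hG, hG]
      congr 2
      funext i; fin_cases i <;> simp [sqz, scale9]
  obtain ⟨S, hS⟩ := hmem
  have hS' : ∀ c, vd (hd c) = 0 → eval c F = eval (gens c) S := by
    intro c hc
    obtain ⟨e, rfl⟩ := exists_sqz hc
    rw [← hG, ← hS]
    exact aeval_gens_sqz e S
  refine ⟨weightedHomogeneousComponent degT n S, isWeightedHomogeneous_component _ _ _,
    fun c hc => (eval_component_of_scaling fun s _ => ?_).symm⟩
  have e : (fun k => s ^ degT k * gens c k) = gens (fun i => s * c i) :=
    funext fun k => (gens_smul s c k).symm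
  have h0 : vd (hd fun i => s * c i) = 0 := by
    have := gens_smul s c 0
    have e2 : gens c 0 = vd (hd c) := rfl
    rw [e2, hc, mul_zero] at this
    exact this
  rw [e, ← hS' _ h0]
  simpa using eval_smul_of_isWeightedHomogeneous hn s c

theorem Inv10.exists_gens_of_homogeneous (n : ℕ) : ∀ {F : MvPolynomial (Fin 10) ℂ}, Inv10 F →
    IsWeightedHomogeneous (fun _ => 1) F n →
    ∃ S : MvPolynomial (Fin 18) ℂ, F = aeval (gens X) S := by
  induction n using Nat.strong_induction_on with
  | _ n ih =>
  intro F hF hn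
  obtain ⟨S, hS, hFS⟩ := hF.exists_restriction hn
  obtain ⟨F₁, hF₁⟩ := dvd_of_vanish dP_irreducible (P := F - aeval (gens X) S) fun c hc => by
    rw [eval_dP] at hc
    rw [map_sub, eval_aeval_gens, hFS c hc, sub_self]
  have hinv : Inv10 (dP * F₁) := fun p q r s hd c => by
    rw [← hF₁, map_sub, map_sub, hF p q r s hd, inv10_aeval_gens S p q r s hd]
  have hhom : IsWeightedHomogeneous (fun _ => 1) (dP * F₁) n := by
    rw [← hF₁]
    refine isWeightedHomogeneous_of_eval fun s _ c => ?_
    have e : (fun i => s * c i) = fun i => s ^ 1 * c i := by simp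
    rw [map_sub, map_sub, eval_aeval_gens, eval_aeval_gens,
      eval_smul_of_isWeightedHomogeneous hn, ← e,
      show gens (fun i => s * c i) = fun k => s ^ degT k * gens c k from
        funext fun k => gens_smul s c k, eval_smul_of_isWeightedHomogeneous hS]
    ring
  have hinv' := hinv.of_mul
  rcases isWeightedHomogeneous_of_mul dP_irreducible.ne_zero isWeightedHomogeneous_dP hhom with
    rfl | ⟨k, rfl, hk⟩
  · exact ⟨S, by rw [mul_zero] at hF₁; exact sub_eq_zero.1 hF₁⟩
  · obtain ⟨S₁, rfl⟩ := ih k (by omega) hinv' hk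
    exact ⟨S + X 0 * S₁, by rw [map_add, map_mul, aeval_X, ← hF₁]; ring⟩

/-- Every invariant is a polynomial in the eighteen generators. -/
theorem Inv10.exists_gens {F : MvPolynomial (Fin 10) ℂ} (hF : Inv10 F) :
    ∃ S : MvPolynomial (Fin 18) ℂ, F = aeval (gens X) S := by
  obtain ⟨N, hN⟩ := sum_component (fun _ => 1) F
  have hinv : ∀ k, Inv10 (weightedHomogeneousComponent (fun _ => 1) k F) := by
    intro k p q r s hdet c
    refine eval_component_eq (fun t _ => ?_) k
    rw [pow_one, ← act_smul, hF p q r s hdet]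
  have h : ∀ k, ∃ S : MvPolynomial (Fin 18) ℂ,
      weightedHomogeneousComponent (fun _ => 1) k F = aeval (gens X) S := fun k =>
    Inv10.exists_gens_of_homogeneous k (hinv k) (isWeightedHomogeneous_component _ _ _)
  choose S hS using h
  exact ⟨∑ k ∈ Finset.range N, S k, by rw [map_sum]; simpa only [← hS] using hN⟩

section Slice

/-- The points with `x = e₁` and `w = q e₂²`. -/
def slice {K : Type*} [CommRing K] (q : K) (a : Fin 5 → K) : Fin 10 → K :=
  mk ![1, 0, 0, 0, q] a

theorem gens_slice {K : Type*} [CommRing K] (q : K) (a : Fin 5 → K) :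
    gens (slice q a) = ![0, qi a, qj a, q, q ^ 2 * a 4, q * a 2, q ^ 2 * hess a 4, a 0,
      q ^ 2 * a 3, q * hess a 2, hess a 0, q * a 1, q ^ 2 * hess a 3, q ^ 3 * sext a 6,
      q * hess a 1, q ^ 2 * sext a 4, q * sext a 2, sext a 0] := by
  rw [gens, slice, hd_mk, tl_mk]
  have hQ : ∀ b : Fin 5 → K, qgen ![1, 0, 0, 0, q] b
      = ![b 0, q * b 1, q * b 2, q ^ 2 * b 3, q ^ 2 * b 4] := by
    intro b
    funext k
    fin_cases k <;> simp [qgen, qua, cub, quad, lin, cw] <;> ring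
  have hS : ∀ b : Fin 7 → K, sgen ![1, 0, 0, 0, q] b
      = ![b 0, q * b 2, q ^ 2 * b 4, q ^ 3 * b 6] := by
    intro b
    funext k
    fin_cases k
    · simp [sgen, hQ, sq, quad, lin]
    · simp [sgen, hQ, sq, quad, lin]
    · simp [sgen, hQ, sq, quad, lin]
    · simp [sgen]; ring
  have hd0 : vd ![(1 : K), 0, 0, 0, q] = 0 := by simp [vd]
  have hq0 : vq ![(1 : K), 0, 0, 0, q] = q := by simp [vq]
  rw [gen, hQ, hQ, hS, hd0, hq0]
  rfl

/-- A polynomial relation between the generators which holds on the slice holds up to a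
multiple of the discriminant. -/
theorem exists_of_slice {r : MvPolynomial (Fin 18) ℂ}
    (h : ∀ q a, eval (gens (slice q a)) r = 0) :
    ∃ S : MvPolynomial (Fin 18) ℂ, aeval (gens (X : Fin 10 → MvPolynomial (Fin 10) ℂ)) r
      = dP * aeval (gens X) S := by
  have h9 : aeval (sqz (X : Fin 9 → MvPolynomial (Fin 9) ℂ))
      (aeval (gens (X : Fin 10 → MvPolynomial (Fin 10) ℂ)) r) = 0 := by
    refine eval_eq_zero_of_mul zP_ne_zero fun e he => ?_
    rw [eval_zP] at he
    have e1 : (fun k => eval e (sqz (X : Fin 9 → MvPolynomial (Fin 9) ℂ) k)) = sqz e := by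
      funext k; fin_cases k <;> simp [sqz]
    rw [eval_aeval, e1, eval_aeval_gens]
    have hz : e 0 * e 3 - e 1 * e 2 ≠ 0 := he
    have hdet : e 0 * (e 3 / zf e) - (e 2 / zf e) * e 1 = 1 := by
      rw [zf]; field_simp
    rw [← gens_act hdet, ← sqz_act9]
    have hs : sqz (act9 (e 0) (e 2 / zf e) (e 1) (e 3 / zf e) e)
        = slice (zf e ^ 2) (qact (e 0) (e 2 / zf e) (e 1) (e 3 / zf e) (tl9 e)) := by
      have h0 : e 3 / zf e * e 0 - e 2 / zf e * e 1 = 1 := by rw [← hdet]; ring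
      have h1 : -e 1 * e 0 + e 0 * e 1 = 0 := by ring
      have h2 : e 3 / zf e * e 2 - e 2 / zf e * e 3 = 0 := by ring
      have h3 : -e 1 * e 2 + e 0 * e 3 = zf e := by rw [zf]; ring
      rw [act9, h0, h1, h2, h3]
      generalize qact (e 0) (e 2 / zf e) (e 1) (e 3 / zf e) (tl9 e) = b
      generalize zf e = z
      funext k; fin_cases k <;> simp [sqz, slice, mk]
    rw [hs]
    exact h _ _
  have hdvd : dP ∣ aeval (gens (X : Fin 10 → MvPolynomial (Fin 10) ℂ)) r := by
    refine dvd_of_vanish dP_irreducible fun c hc => ?_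
    rw [eval_dP] at hc
    obtain ⟨e, rfl⟩ := exists_sqz hc
    have e1 : (fun k => eval e (sqz (X : Fin 9 → MvPolynomial (Fin 9) ℂ) k)) = sqz e := by
      funext k; fin_cases k <;> simp [sqz]
    rw [← e1, ← eval_aeval, h9, map_zero]
  obtain ⟨F, hF⟩ := hdvd
  have hinv : Inv10 F := Inv10.of_mul (by rw [← hF]; exact inv10_aeval_gens r)
  obtain ⟨S, rfl⟩ := hinv.exists_gens
  exact ⟨S, hF⟩

end Slice

section Vanishing

variable {K : Type*} [CommRing K] [IsDomain K] [CharZero K]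

/-- A homomorphism to a domain which respects the relations between the generators on the slice
and kills the parameters kills all the generators. -/
theorem eq_zero_of_params (φ : MvPolynomial (Fin 18) ℂ →+* K)
    (hφ : ∀ r, (∀ q a, eval (gens (slice q a)) r = 0) → φ r = 0)
    (h1 : φ (X 1) = 0) (h2 : φ (X 2) = 0) (h34 : φ (X 3) + φ (X 4) = 0)
    (h56 : φ (X 5) + φ (X 6) = 0) (h7 : φ (X 7) = 0) (h10 : φ (X 10) + φ (X 4) ^ 2 = 0)
    (k : Fin 18) : φ (X k) = 0 := by
  have e0 : ∀ q a, gens (slice q a) 0 = (0 : ℂ) := fun q a => by rw [gens_slice]; rfl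
  have e1 : ∀ q a, gens (slice q a) 1 = qi (K := ℂ) a := fun q a => by rw [gens_slice]; rfl
  have e2 : ∀ q a, gens (slice q a) 2 = qj (K := ℂ) a := fun q a => by rw [gens_slice]; rfl
  have e3 : ∀ (q : ℂ) a, gens (slice q a) 3 = q := fun q a => by rw [gens_slice]; rfl
  have e4 : ∀ (q : ℂ) a, gens (slice q a) 4 = q ^ 2 * a 4 := fun q a => by rw [gens_slice]; rfl
  have e5 : ∀ (q : ℂ) a, gens (slice q a) 5 = q * a 2 := fun q a => by rw [gens_slice]; rfl
  have e6 : ∀ (q : ℂ) a, gens (slice q a) 6 = q ^ 2 * hess a 4 := fun q a => by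
    rw [gens_slice]; rfl
  have e7 : ∀ (q : ℂ) a, gens (slice q a) 7 = a 0 := fun q a => by rw [gens_slice]; rfl
  have e8 : ∀ (q : ℂ) a, gens (slice q a) 8 = q ^ 2 * a 3 := fun q a => by rw [gens_slice]; rfl
  have e9 : ∀ (q : ℂ) a, gens (slice q a) 9 = q * hess a 2 := fun q a => by rw [gens_slice]; rfl
  have e10 : ∀ (q : ℂ) a, gens (slice q a) 10 = hess a 0 := fun q a => by rw [gens_slice]; rfl
  have e11 : ∀ (q : ℂ) a, gens (slice q a) 11 = q * a 1 := fun q a => by rw [gens_slice]; rfl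
  have e12 : ∀ (q : ℂ) a, gens (slice q a) 12 = q ^ 2 * hess a 3 := fun q a => by
    rw [gens_slice]; rfl
  have e13 : ∀ (q : ℂ) a, gens (slice q a) 13 = q ^ 3 * sext a 6 := fun q a => by
    rw [gens_slice]; rfl
  have e14 : ∀ (q : ℂ) a, gens (slice q a) 14 = q * hess a 1 := fun q a => by
    rw [gens_slice]; rfl
  have e15 : ∀ (q : ℂ) a, gens (slice q a) 15 = q ^ 2 * sext a 4 := fun q a => by
    rw [gens_slice]; rfl
  have e16 : ∀ (q : ℂ) a, gens (slice q a) 16 = q * sext a 2 := fun q a => by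
    rw [gens_slice]; rfl
  have e17 : ∀ (q : ℂ) a, gens (slice q a) 17 = sext a 0 := fun q a => by rw [gens_slice]; rfl
  have s0 : ∀ a : Fin 5 → ℂ, hess a 0 = 6 * (a 0 * a 2 - a 1 ^ 2) := fun a => rfl
  have s1 : ∀ a : Fin 5 → ℂ, hess a 1 = 3 * (a 0 * a 3 - a 1 * a 2) := fun a => rfl
  have s2 : ∀ a : Fin 5 → ℂ, hess a 2 = a 0 * a 4 + 2 * a 1 * a 3 - 3 * a 2 ^ 2 := fun a => rfl
  have s3 : ∀ a : Fin 5 → ℂ, hess a 3 = 3 * (a 1 * a 4 - a 2 * a 3) := fun a => rfl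
  have s4 : ∀ a : Fin 5 → ℂ, hess a 4 = 6 * (a 2 * a 4 - a 3 ^ 2) := fun a => rfl
  have t0 : ∀ a : Fin 5 → ℂ, sext a 0 = 6 * (a 0 ^ 2 * a 3 - 3 * a 0 * a 1 * a 2 + 2 * a 1 ^ 3) :=
    fun a => rfl
  have t2 : ∀ a : Fin 5 → ℂ,
      sext a 2 = 2 * (a 0 * a 1 * a 4 + 2 * a 1 ^ 2 * a 3 - 3 * a 0 * a 2 * a 3) := fun a => rfl
  have t4 : ∀ a : Fin 5 → ℂ,
      sext a 4 = -(2 * (a 0 * a 3 * a 4 + 2 * a 1 * a 3 ^ 2 - 3 * a 1 * a 2 * a 4)) :=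
    fun a => rfl
  have t6 : ∀ a : Fin 5 → ℂ,
      sext a 6 = -(6 * (a 1 * a 4 ^ 2 - 3 * a 2 * a 3 * a 4 + 2 * a 3 ^ 3)) := fun a => rfl
  have r1 := hφ (6 * X 11 ^ 2 - (6 * X 7 * X 5 * X 3 - X 10 * X 3 ^ 2)) fun q a => by
    simp only [map_sub, map_mul, map_pow, map_ofNat, eval_X, e3, e5, e7, e10, e11, s0]
    ring
  have r2 := hφ (6 * X 8 ^ 2 - (6 * X 5 * X 4 * X 3 - X 6 * X 3 ^ 2)) fun q a => by
    simp only [map_sub, map_mul, map_pow, map_ofNat, eval_X, e3, e4, e5, e6, e8, s4]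
    ring
  have r3 := hφ (4 * X 11 * X 8 - X 3 * (3 * X 5 ^ 2 + X 7 * X 4 - X 3 ^ 2 * X 1)) fun q a => by
    simp only [map_sub, map_mul, map_add, map_pow, map_ofNat, eval_X, e1, e3, e4, e5, e7, e8,
      e11, qi]
    ring
  have r4 := hφ (3 * (X 7 * X 4 - X 5 ^ 2) - (2 * X 3 * X 9 + X 3 ^ 2 * X 1)) fun q a => by
    simp only [map_sub, map_mul, map_add, map_pow, map_ofNat, eval_X, e1, e3, e4, e5, e7, e9, s2,
      qi]
    ring
  have r5 := hφ (X 3 ^ 4 * X 2 - (X 3 * X 7 * X 5 * X 4 + 2 * X 11 * X 8 * X 5 - X 3 * X 5 ^ 3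
      - X 7 * X 8 ^ 2 - X 11 ^ 2 * X 4)) fun q a => by
    simp only [map_sub, map_mul, map_add, map_pow, map_ofNat, eval_X, e2, e3, e4, e5, e7, e8, e11,
      qj]
    ring
  have r6 := hφ (X 9 ^ 2 - (X 10 * X 6 - 36 * X 5 * X 3 * X 2 + 3 * X 5 ^ 2 * X 1
      - 3 * X 7 * X 4 * X 1 + 4 * X 9 * X 1 * X 3)) fun q a => by
    simp only [map_sub, map_mul, map_add, map_pow, map_ofNat, eval_X, e1, e2, e3, e4, e5, e6, e7,
      e9, e10, s0, s2, s4, qi, qj]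
    ring
  have r7 := hφ (2 * X 14 ^ 2 - (12 * X 16 * X 11 - 3 * X 7 ^ 2 * X 6 - 6 * X 9 * X 7 * X 5
      + 9 * X 10 * X 5 ^ 2 + 4 * X 10 * X 9 * X 3)) fun q a => by
    simp only [map_sub, map_mul, map_add, map_pow, map_ofNat, eval_X, e3, e5, e6, e7,
      e9, e10, e11, e14, e16, s0, s1, s2, s4, t2]
    ring
  have r8 := hφ (2 * X 12 ^ 2 - (-(3 * X 13 * X 11) - 3 * X 15 * X 8 + 9 * X 6 * X 5 ^ 2
      - 3 * X 7 * X 6 * X 4 - 6 * X 5 * X 9 * X 4 + 4 * X 9 * X 6 * X 3)) fun q a => by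
    simp only [map_sub, map_mul, map_add, map_neg, map_pow, map_ofNat, eval_X, e3, e4, e5, e6, e7,
      e8, e9, e11, e12, e13, e15, s2, s3, s4, t4, t6]
    ring
  have r9 := hφ (3 * X 17 ^ 2 - (-(2 * X 10 ^ 3) - 108 * X 7 ^ 3 * X 2
      + 18 * X 10 * X 7 ^ 2 * X 1)) fun q a => by
    simp only [map_sub, map_mul, map_add, map_neg, map_pow, map_ofNat, eval_X, e1, e2, e7, e10,
      e17, s0, t0, qi, qj]
    ring
  have r10 := hφ (3 * X 13 ^ 2 - (-(2 * X 6 ^ 3) - 108 * X 4 ^ 3 * X 2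
      + 18 * X 6 * X 4 ^ 2 * X 1)) fun q a => by
    simp only [map_sub, map_mul, map_add, map_neg, map_pow, map_ofNat, eval_X, e1, e2, e4, e6,
      e13, s4, t6, qi, qj]
    ring
  have r11 := hφ (3 * X 16 ^ 2 - (3 * X 17 * X 15 - 72 * X 14 * X 11 * X 2 + 8 * X 14 ^ 2 * X 1
      + 6 * X 16 * X 11 * X 1 - 6 * X 17 * X 8 * X 1)) fun q a => by
    simp only [map_sub, map_mul, map_add, map_pow, map_ofNat, eval_X, e1, e2, e8, e11,
      e14, e15, e16, e17, s1, t0, t2, t4, qi, qj]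
    ring
  have r12 := hφ (3 * X 15 ^ 2 - (3 * X 16 * X 13 - 72 * X 12 * X 8 * X 2 + 8 * X 12 ^ 2 * X 1
      + 6 * X 13 * X 11 * X 1 - 6 * X 15 * X 8 * X 1)) fun q a => by
    simp only [map_sub, map_mul, map_add, map_pow, map_ofNat, eval_X, e1, e2, e8, e11,
      e12, e13, e15, e16, s3, t2, t4, t6, qi, qj]
    ring
  have r0 := hφ (X 0) fun q a => by rw [eval_X, e0]
  clear hφ e0 e1 e2 e3 e4 e5 e6 e7 e8 e9 e10 e11 e12 e13 e14 e15 e16 e17 s0 s1 s2 s3 s4 t0 t2 t4 t6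
  simp only [map_sub, map_mul, map_add, map_neg, map_pow, map_ofNat] at *
  have h4 : φ (X 4) = -φ (X 3) := by linear_combination h34
  have h6 : φ (X 6) = -φ (X 5) := by linear_combination h56
  have h10' : φ (X 10) = -φ (X 3) ^ 2 := by rw [h4] at h10; linear_combination h10
  rw [h10', h7] at r1
  rw [h4, h6] at r2
  rw [h1, h7] at r3
  rw [h2, h4, h7] at r5
  have u : 3 * φ (X 3) * φ (X 5) ^ 3 + φ (X 3) ^ 5 = 0 := by
    linear_combination -(6 * r5 + 3 * φ (X 5) * r3 + φ (X 3) * r1)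
  have v : φ (X 5) * φ (X 3) ^ 6 * 28 = 0 := by
    linear_combination 9 * (4 * φ (X 11) * φ (X 8) + 3 * φ (X 3) * φ (X 5) ^ 2) * 4 * r3
      - 96 * φ (X 8) ^ 2 * r1 - 16 * φ (X 3) ^ 4 * r2 + 108 * φ (X 3) * φ (X 5) * u
  have q0 : φ (X 3) = 0 := by
    have : φ (X 3) ^ 5 * φ (X 3) = 0 := by
      rcases mul_eq_zero.1 v with v | v
      · rcases mul_eq_zero.1 v with v | v
        · rw [v] at u
          linear_combination φ (X 3) * u
        · linear_combination v
      · norm_num at v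
    exact pow_eq_zero_iff (n := 6) (by norm_num) |>.1 (by linear_combination this)
  have z4 : φ (X 4) = 0 := by rw [h4, q0, neg_zero]
  have z10 : φ (X 10) = 0 := by rw [h10', q0]; ring
  have sq0 : ∀ (n : ℕ) [n.AtLeastTwo] (x : K), (OfNat.ofNat n : K) * x ^ 2 = 0 → x = 0 := by
    intro n _ x h
    exact pow_eq_zero_iff two_ne_zero |>.1
      ((mul_eq_zero.1 h).resolve_left (OfNat.ofNat_ne_zero n))
  have z11 : φ (X 11) = 0 := sq0 6 _ (by rw [q0] at r1; linear_combination r1)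
  have z8 : φ (X 8) = 0 := sq0 6 _ (by rw [q0] at r2; linear_combination r2)
  have z5 : φ (X 5) = 0 := sq0 3 _ (by rw [q0, h7] at r4; linear_combination -r4)
  have z6 : φ (X 6) = 0 := by rw [h6, z5, neg_zero]
  have z9 : φ (X 9) = 0 := sq0 2 _ (by
    rw [z10, z5, h7, h1] at r6; linear_combination 2 * r6)
  have z14 : φ (X 14) = 0 := sq0 2 _ (by
    rw [z11, h7, z9, z10] at r7; linear_combination r7)
  have z12 : φ (X 12) = 0 := sq0 2 _ (by
    rw [z11, h7, z9, z8, z6] at r8; linear_combination r8)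
  have z17 : φ (X 17) = 0 := sq0 3 _ (by rw [h7, z10] at r9; linear_combination r9)
  have z13 : φ (X 13) = 0 := sq0 3 _ (by rw [z4, z6] at r10; linear_combination r10)
  have z16 : φ (X 16) = 0 := sq0 3 _ (by
    rw [z17, h1, h2] at r11; linear_combination r11)
  have z15 : φ (X 15) = 0 := sq0 3 _ (by
    rw [z13, h1, h2] at r12; linear_combination r12)
  fin_cases k <;> assumption

end Vanishing

theorem component_mul {σ : Type*} {w : σ → ℕ} {p : MvPolynomial σ ℂ} {d : ℕ}
    (hp : IsWeightedHomogeneous w p d) (F : MvPolynomial σ ℂ) (n : ℕ) :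
    weightedHomogeneousComponent w n (p * F)
      = if d ≤ n then p * weightedHomogeneousComponent w (n - d) F else 0 := by
  apply MvPolynomial.funext
  intro c
  have e : curve w c p = Polynomial.C (eval c p) * Polynomial.X ^ d :=
    polynomial_ext_of_ne_zero fun s _ => by
      rw [eval_curve, eval_smul_of_isWeightedHomogeneous hp, Polynomial.eval_C_mul,
        Polynomial.eval_pow, Polynomial.eval_X, mul_comm]
  rw [← coeff_curve, map_mul, e, mul_assoc, Polynomial.coeff_C_mul, Polynomial.coeff_X_pow_mul']
  split_ifs
  · rw [coeff_curve, map_mul]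
  · simp

theorem component_aeval_gens (n : ℕ) (S : MvPolynomial (Fin 18) ℂ) :
    weightedHomogeneousComponent (fun _ => 1) n
        (aeval (gens (X : Fin 10 → MvPolynomial (Fin 10) ℂ)) S)
      = aeval (gens X) (weightedHomogeneousComponent degT n S) := by
  apply MvPolynomial.funext
  intro c
  rw [eval_aeval_gens]
  refine eval_component_eq (fun s _ => ?_) n
  rw [eval_aeval_gens]
  congr 2
  funext k
  rw [← gens_smul]; simp

/-- The ring of invariants. -/
def ring10 : Subalgebra ℂ (MvPolynomial (Fin 10) ℂ) where
  carrier := {F | Inv10 F}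
  mul_mem' := fun ha hb p q r s h c => by rw [map_mul, map_mul, ha p q r s h, hb p q r s h]
  add_mem' := fun ha hb p q r s h c => by rw [map_add, map_add, ha p q r s h, hb p q r s h]
  algebraMap_mem' := fun t p q r s h c => by simp

/-- The presentation of the ring of invariants by the generators. -/
def pres : MvPolynomial (Fin 18) ℂ →ₐ[ℂ] ring10 :=
  (aeval (gens X)).codRestrict ring10 inv10_aeval_gens

theorem coe_pres (S : MvPolynomial (Fin 18) ℂ) :
    (pres S : MvPolynomial (Fin 10) ℂ) = aeval (gens X) S := rfl

theorem pres_surjective : Function.Surjective pres := by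
  rintro ⟨F, hF⟩
  obtain ⟨S, rfl⟩ := hF.exists_gens
  exact ⟨S, rfl⟩

theorem pres_component {S T : MvPolynomial (Fin 18) ℂ} (h : pres S = pres T) (n : ℕ) :
    pres (weightedHomogeneousComponent degT n S) = pres (weightedHomogeneousComponent degT n T) :=
  Subtype.ext <| by
    rw [coe_pres, coe_pres, ← component_aeval_gens, ← component_aeval_gens, ← coe_pres, h, coe_pres]

/-- A homogeneous system of parameters, in terms of the generators. -/
def prm : Fin 7 → MvPolynomial (Fin 18) ℂ :=
  ![X 0, X 1, X 2, X 3 + X 4, X 5 + X 6, X 7, X 10 + X 4 ^ 2]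

/-- The degrees of the parameters. -/
def degP : Fin 7 → ℕ := ![2, 2, 3, 3, 4, 5, 6]

theorem isWeightedHomogeneous_prm (j : Fin 7) : IsWeightedHomogeneous degT (prm j) (degP j) := by
  have hX : ∀ k, IsWeightedHomogeneous degT (X k : MvPolynomial (Fin 18) ℂ) (degT k) :=
    isWeightedHomogeneous_X ℂ degT
  fin_cases j
  · exact hX 0
  · exact hX 1
  · exact hX 2
  · exact (hX 3).add (hX 4)
  · exact (hX 5).add (hX 6)
  · exact hX 7
  · exact (hX 10).add ((hX 4).pow 2)

theorem degP_pos (j : Fin 7) : 0 < degP j := by fin_cases j <;> norm_num [degP]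

/-- The ideal generated by the parameters. -/
def idealP : Ideal ring10 := Ideal.span (Set.range fun j => pres (prm j))

theorem pres_prm_mem (j : Fin 7) : pres (prm j) ∈ idealP := Ideal.subset_span ⟨j, rfl⟩

theorem pres_X_mem_radical (k : Fin 18) : pres (X k) ∈ idealP.radical := by
  rw [Ideal.radical_eq_sInf, Submodule.mem_sInf]
  rintro 𝔭 ⟨hle, hp⟩
  let φ : MvPolynomial (Fin 18) ℂ →+* ring10 ⧸ 𝔭 := (Ideal.Quotient.mk 𝔭).comp pres.toRingHom
  have hφ : ∀ S, φ S = Ideal.Quotient.mk 𝔭 (pres S) := fun S => rfl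
  have : CharZero (ring10 ⧸ 𝔭) :=
    charZero_of_injective_algebraMap (algebraMap ℂ (ring10 ⧸ 𝔭)).injective
  have hP : ∀ j, φ (prm j) = 0 := fun j =>
    Ideal.Quotient.eq_zero_iff_mem.2 (hle (pres_prm_mem j))
  suffices hk : φ (X k) = 0 from Ideal.Quotient.eq_zero_iff_mem.1 hk
  refine @eq_zero_of_params (ring10 ⧸ 𝔭) _ _ _ φ (fun r hr => ?_) ?_ ?_ ?_ ?_ ?_ ?_ k
  · obtain ⟨S, hS⟩ := exists_of_slice hr
    have : pres r = pres (prm 0) * pres S := Subtype.ext <| by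
      rw [MulMemClass.coe_mul, coe_pres, coe_pres, coe_pres, hS]
      congr 1
      exact (aeval_X _ _).symm
    rw [hφ, this, map_mul, ← hφ, hP 0, zero_mul]
  · exact hP 1
  · exact hP 2
  · rw [← map_add]; exact hP 3
  · rw [← map_add]; exact hP 4
  · exact hP 5
  · rw [← map_pow, ← map_add]; exact hP 6

theorem exists_pow_mem : ∃ N, ∀ k, pres (X k) ^ N ∈ idealP := by
  choose n hn using pres_X_mem_radical
  refine ⟨∑ k, n k, fun k => ?_⟩
  exact Ideal.pow_mem_of_pow_mem _ (hn k) (Finset.single_le_sum (f := n) (fun _ _ => Nat.zero_le _)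
    (Finset.mem_univ k))

/-- The algebra generated by the parameters. -/
def algP : Subalgebra ℂ ring10 := Algebra.adjoin ℂ (Set.range fun j => pres (prm j))

theorem pres_mem_of_isWeightedHomogeneous {M : Submodule algP ring10} {N : ℕ}
    (hN : ∀ k, pres (X k) ^ N ∈ idealP)
    (hM : ∀ m : Fin 18 →₀ ℕ, (∀ k, m k < N) → pres (monomial m 1) ∈ M) (n : ℕ) :
    ∀ S, IsWeightedHomogeneous degT S n → pres S ∈ M := by
  induction n using Nat.strong_induction_on with
  | _ n ih =>
  intro S hS
  rw [S.as_sum, map_sum]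
  refine Submodule.sum_mem _ fun m hm => ?_
  have hmon : monomial m (coeff m S) = (coeff m S) • monomial m (1 : ℂ) := by
    rw [smul_monomial, smul_eq_mul, mul_one]
  rw [hmon, map_smul]
  refine M.smul_of_tower_mem _ ?_
  by_cases hm' : ∀ k, m k < N
  · exact hM m hm'
  push Not at hm'
  obtain ⟨k, hk⟩ := hm'
  obtain ⟨c, hc⟩ := (Ideal.mem_span_range_iff_exists_fun).1 (hN k)
  have hw : IsWeightedHomogeneous degT (monomial m (1 : ℂ)) n :=
    isWeightedHomogeneous_monomial _ _ _ (hS (mem_support_iff.1 hm))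
  choose T hT using fun j => pres_surjective (c j)
  let m' := m - Finsupp.single k N
  have hsplit : monomial m (1 : ℂ) = X k ^ N * monomial m' 1 := by
    rw [X_pow_eq_monomial, monomial_mul, one_mul, add_tsub_cancel_of_le (Finsupp.single_le_iff.2 hk)]
  have h1 : pres (monomial m 1) = pres (∑ j, prm j * (T j * monomial m' 1)) := by
    rw [hsplit, map_mul, map_pow, ← hc, map_sum, Finset.sum_mul]
    refine Finset.sum_congr rfl fun j _ => ?_
    rw [map_mul, map_mul, hT]; ring
  have h2 := pres_component h1 n
  rw [hw.weightedHomogeneousComponent_same, map_sum, map_sum] at h2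
  rw [h2]
  refine Submodule.sum_mem _ fun j _ => ?_
  rw [component_mul (isWeightedHomogeneous_prm j)]
  split_ifs with hd
  · rw [map_mul]
    have := M.smul_mem (⟨pres (prm j), Algebra.subset_adjoin ⟨j, rfl⟩⟩ : algP)
      (ih (n - degP j) (by have := degP_pos j; omega) _
        (isWeightedHomogeneous_component degT (n - degP j) (T j * monomial m' 1)))
    exact this
  · rw [map_zero]; exact M.zero_mem

theorem finite_algP : Module.Finite algP ring10 := by
  obtain ⟨N, hN⟩ := exists_pow_mem
  have hfin : (Set.range fun e : Fin 18 → Fin N =>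
      pres (monomial (Finsupp.equivFunOnFinite.symm fun k => (e k : ℕ)) 1)).Finite :=
    Set.finite_range _
  refine Module.finite_def.2 (Submodule.fg_def.2 ⟨_, hfin, ?_⟩)
  rw [Submodule.eq_top_iff']
  intro F
  obtain ⟨S, rfl⟩ := pres_surjective F
  obtain ⟨L, hL⟩ := sum_component degT S
  rw [hL, map_sum]
  refine Submodule.sum_mem _ fun n _ => pres_mem_of_isWeightedHomogeneous hN (fun m hm => ?_) n _
    (isWeightedHomogeneous_component _ _ _)
  refine Submodule.subset_span ⟨fun k => ⟨m k, hm k⟩, ?_⟩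
  exact congrArg (fun m => pres (monomial m 1)) (Finsupp.ext fun k => rfl)

/-- Values of seven invariants on points with `x = e₁`. -/
theorem gens_section (w q : ℂ) (a : Fin 5 → ℂ) :
    gens (mk ![1, 0, w, 0, q] a) 0 = w * q ∧ gens (mk ![1, 0, w, 0, q] a) 3 = q ∧
    gens (mk ![1, 0, w, 0, q] a) 7 = a 0 ∧ gens (mk ![1, 0, w, 0, q] a) 11 = q * a 1 ∧
    gens (mk ![1, 0, w, 0, q] a) 5 = a 0 * w + q * a 2 ∧
    gens (mk ![1, 0, w, 0, q] a) 8 = q * (a 1 * w + q * a 3) ∧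
    gens (mk ![1, 0, w, 0, q] a) 4 = a 0 * w ^ 2 + 2 * a 2 * w * q + q ^ 2 * a 4 := by
  refine ⟨?_, ?_, ?_, ?_, ?_, ?_, ?_⟩ <;> rw [gens, hd_mk, tl_mk] <;>
    simp [gen, vd, vq, qgen, qua, cub, quad, lin, cw] <;> ring

theorem algebraicIndependent_seven :
    AlgebraicIndependent ℂ fun j : Fin 7 => pres (X ((![0, 3, 7, 11, 5, 8, 4] : Fin 7 → Fin 18) j)) := by
  rw [algebraicIndependent_iff]
  intro T hT
  refine eval_eq_zero_of_mul (Q := X 1) (X_ne_zero _) fun y hy => ?_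
  rw [eval_X] at hy
  let w := y 0 / y 1
  let a2 := (y 4 - y 2 * w) / y 1
  let a : Fin 5 → ℂ := ![y 2, y 3 / y 1, a2, (y 5 / y 1 - y 3 / y 1 * w) / y 1,
    (y 6 - y 2 * w ^ 2 - 2 * a2 * w * y 1) / y 1 ^ 2]
  obtain ⟨h0, h1, h2, h3, h4, h5, h6⟩ := gens_section w (y 1) a
  have e : y = fun j => gens (mk ![1, 0, w, 0, y 1] a)
      ((![0, 3, 7, 11, 5, 8, 4] : Fin 7 → Fin 18) j) := by
    funext j
    fin_cases j
    · refine Eq.trans ?_ h0.symm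
      simp only [w]; field_simp; rfl
    · exact h1.symm
    · exact h2.symm
    · refine Eq.trans ?_ h3.symm
      simp [a]; field_simp
    · refine Eq.trans ?_ h4.symm
      simp [a, a2]; field_simp; ring
    · refine Eq.trans ?_ h5.symm
      simp [a]; field_simp; ring
    · refine Eq.trans ?_ h6.symm
      simp [a]; field_simp; ring
  have h := congrArg (fun F : ring10 => eval (mk ![1, 0, w, 0, y 1] a) (F : MvPolynomial (Fin 10) ℂ)) hT
  simp only [ZeroMemClass.coe_zero, map_zero] at h
  rw [← h]
  have h7 : (aeval fun j : Fin 7 => pres (X ((![0, 3, 7, 11, 5, 8, 4] : Fin 7 → Fin 18) j))) T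
      = pres (rename (![0, 3, 7, 11, 5, 8, 4] : Fin 7 → Fin 18) T) := by
    refine DFunLike.congr_fun (f := aeval _) (g := pres.comp (rename _)) ?_ T
    ext j; simp
  rw [h7, coe_pres, eval_aeval_gens, eval_rename]
  conv_lhs => rw [e]
  rfl

theorem algebraicIndependent_prm : AlgebraicIndependent ℂ fun j => pres (prm j) := by
  have hle := algebraicIndependent_seven.cardinalMk_le_trdeg
  have := finite_algP
  have h : Algebra.IsIntegral algP ring10 := Algebra.IsIntegral.of_finite _ _
  have : Algebra.IsAlgebraic (Algebra.adjoin ℂ (Set.range fun j => pres (prm j))) ring10 :=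
    h.isAlgebraic
  exact (Algebra.IsAlgebraic.isTranscendenceBasis_of_le_trdeg_of_finite ℂ
    (fun j => pres (prm j)) hle).1

theorem sum_fin_eighteen {M : Type*} [AddCommMonoid M] (f : Fin 18 → M) :
    ∑ j, f j = f 0 + (f 1 + (f 2 + (f 3 + (f 4 + (f 5 + (f 6 + (f 7 + (f 8 + (f 9 + (f 10 + (f 11
      + (f 12 + (f 13 + (f 14 + (f 15 + (f 16 + f 17)))))))))))))))) := by
  simp only [Fin.sum_univ_succ, Finset.univ_eq_empty, Finset.sum_empty, add_zero]
  rfl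

set_option maxHeartbeats 8000000 in
theorem ne_zero_of_weight (m : Fin 18 → ℕ) (k : Fin 18) (hX : ∑ j, m j * degX j = degX k)
    (hW : ∑ j, m j * degW j = degW k) (hA : ∑ j, m j * degA j = degA k) (h1 : k ≠ 1 → m 1 = 0) :
    m k ≠ 0 := by
  have hX' : 2 * m 3 + 2 * m 5 + 4 * m 7 + 2 * m 8 + 2 * m 9 + 4 * m 10 + 4 * m 11 + 2 * m 12
      + 4 * m 14 + 2 * m 15 + 4 * m 16 + 6 * m 17 = degX k := by
    rw [← hX, sum_fin_eighteen]; simp [degX]; ring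
  have hW' : 2 * m 0 + m 3 + 2 * m 4 + m 5 + 2 * m 6 + 2 * m 8 + m 9 + m 11 + 2 * m 12
      + 3 * m 13 + m 14 + 2 * m 15 + m 16 = degW k := by
    rw [← hW, sum_fin_eighteen]; simp [degW]; ring
  have hA' : 2 * m 1 + 3 * m 2 + m 4 + m 5 + 2 * m 6 + m 7 + m 8 + 2 * m 9 + 2 * m 10 + m 11
      + 2 * m 12 + 3 * m 13 + 2 * m 14 + 3 * m 15 + 3 * m 16 + 3 * m 17 = degA k := by
    rw [← hA, sum_fin_eighteen]; simp [degA]; ring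
  clear hX hW hA
  obtain ⟨N₂, hN₂⟩ : ∃ N, m 0 + m 3 + (m 4 + m 5 + m 7) + (m 6 + m 9 + m 10) = N := ⟨_, rfl⟩
  obtain ⟨N₃, hN₃⟩ : ∃ N, m 8 + m 11 + (m 12 + m 14) + (m 13 + m 15 + m 16 + m 17) = N := ⟨_, rfl⟩
  have hu : 4 * N₂ + 6 * N₃ = degX k + 2 * degW k := by omega
  have hk : degX k + 2 * degW k ≤ 6 := by fin_cases k <;> decide
  have hN : N₂ = 0 ∧ N₃ = 0 ∨ N₂ = 1 ∧ N₃ = 0 ∨ N₂ = 0 ∧ N₃ = 1 := by omega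
  clear hk
  have c₂ : N₂ = 1 → m 0 + m 3 = 1 ∨ m 4 + m 5 + m 7 = 1 ∨ m 6 + m 9 + m 10 = 1 := by omega
  have c₃ : N₃ = 1 → m 8 + m 11 = 1 ∨ m 12 + m 14 = 1 ∨ m 13 + m 15 + m 16 + m 17 = 1 := by omega
  rcases hN with ⟨rfl, rfl⟩ | ⟨rfl, rfl⟩ | ⟨rfl, rfl⟩
  · fin_cases k <;> simp [degX, degW, degA] at hX' hW' hA' h1 hu ⊢ <;> omega
  · rcases c₂ rfl with h | h | h <;>
      fin_cases k <;> simp [degX, degW, degA] at hX' hW' hA' h1 hu ⊢ <;> omega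
  · have z : m 0 = 0 ∧ m 3 = 0 ∧ m 4 = 0 ∧ m 5 = 0 ∧ m 7 = 0 ∧ m 6 = 0 ∧ m 9 = 0 ∧ m 10 = 0 := by
      omega
    obtain ⟨z0, z3, z4, z5, z7, z6, z9, z10⟩ := z
    simp only [z0, z3, z4, z5, z7, z6, z9, z10, mul_zero, zero_add, add_zero] at hX' hW' hA' hN₃
    rcases c₃ rfl with h | h | h
    · have z : m 12 = 0 ∧ m 14 = 0 ∧ m 13 = 0 ∧ m 15 = 0 ∧ m 16 = 0 ∧ m 17 = 0 := by omega
      obtain ⟨z12, z14, z13, z15, z16, z17⟩ := z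
      simp only [z12, z14, z13, z15, z16, z17, mul_zero, add_zero] at hX' hW' hA'
      fin_cases k <;> simp [degX, degW, degA] at hX' hW' hA' h1 hu ⊢ <;> omega
    · have z : m 8 = 0 ∧ m 11 = 0 ∧ m 13 = 0 ∧ m 15 = 0 ∧ m 16 = 0 ∧ m 17 = 0 := by omega
      obtain ⟨z12, z14, z13, z15, z16, z17⟩ := z
      simp only [z12, z14, z13, z15, z16, z17, mul_zero, zero_add, add_zero] at hX' hW' hA'
      fin_cases k <;> simp [degX, degW, degA] at hX' hW' hA' h1 hu ⊢ <;> omega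
    · have z : m 8 = 0 ∧ m 11 = 0 ∧ m 12 = 0 ∧ m 14 = 0 := by omega
      obtain ⟨z12, z14, z13, z15⟩ := z
      simp only [z12, z14, z13, z15, mul_zero, zero_add, add_zero] at hX' hW' hA'
      fin_cases k <;> simp [degX, degW, degA] at hX' hW' hA' h1 hu ⊢ <;> omega

theorem eq_single_of_weight {m : Fin 18 →₀ ℕ} {k : Fin 18}
    (hX : Finsupp.weight degX m = degX k) (hW : Finsupp.weight degW m = degW k)
    (hA : Finsupp.weight degA m = degA k) (h1 : k ≠ 1 → m 1 = 0) : m = Finsupp.single k 1 := by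
  have hw : ∀ d : Fin 18 → ℕ, Finsupp.weight d m = ∑ j, m j * d j := fun d => by
    rw [Finsupp.weight_apply, Finsupp.sum_fintype _ _ (by simp)]; rfl
  rw [hw] at hX hW hA
  have hk := ne_zero_of_weight m k hX hW hA h1
  have hT : ∑ j, m j * degT j = degT k := by
    rw [degT_eq k, ← hX, ← hW, ← hA, ← Finset.sum_add_distrib, ← Finset.sum_add_distrib]
    exact Finset.sum_congr rfl fun j _ => by rw [degT_eq]; ring
  have hpos : ∀ j, 0 < degT j := by decide
  have hle : Finsupp.single k 1 ≤ m := Finsupp.single_le_iff.2 (Nat.one_le_iff_ne_zero.2 hk)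
  obtain ⟨m', rfl⟩ := exists_add_of_le hle
  have hz : ∑ j, m' j * degT j = 0 := by
    have : ∑ j, (Finsupp.single k 1 : Fin 18 →₀ ℕ) j * degT j = degT k := by
      rw [Finset.sum_eq_single k] <;> simp +contextual [eq_comm]
    simp only [Finsupp.add_apply, add_mul, Finset.sum_add_distrib, this] at hT
    omega
  have : m' = 0 := Finsupp.ext fun j => by
    have := (Finset.sum_eq_zero_iff.1 hz) j (Finset.mem_univ j)
    exact (Nat.mul_eq_zero.1 this).resolve_right (hpos j).ne'
  rw [this, add_zero]

theorem eval_gens_component {T : MvPolynomial (Fin 18) ℂ} (h : ∀ c, eval (gens c) T = 0) (n : ℕ) :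
    (∀ c, eval (gens c) (weightedHomogeneousComponent degX n T) = 0) ∧
    (∀ c, eval (gens c) (weightedHomogeneousComponent degW n T) = 0) ∧
    ∀ c, eval (gens c) (weightedHomogeneousComponent degA n T) = 0 := by
  refine ⟨fun c => eval_component_of_scaling fun s _ => ?_,
    fun c => eval_component_of_scaling fun s _ => ?_,
    fun c => eval_component_of_scaling fun s _ => ?_⟩
  · rw [mul_zero, ← h (scale10 s 1 1 c)]
    exact congrArg (fun f => eval f T) (funext fun k => by rw [gens_scale10]; simp)
  · rw [mul_zero, ← h (scale10 1 s 1 c)]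
    exact congrArg (fun f => eval f T) (funext fun k => by rw [gens_scale10]; simp)
  · rw [mul_zero, ← h (scale10 1 1 s c)]
    exact congrArg (fun f => eval f T) (funext fun k => by rw [gens_scale10]; simp)

/-- There is a point at which only the second-degree invariant of the quartic vanishes. -/
theorem exists_point (k : Fin 18) : ∃ c : Fin 10 → ℂ, gens c k ≠ 0 ∧ (k ≠ 1 → gens c 1 = 0) := by
  by_cases hk : k = 1
  · subst hk
    refine ⟨mk 0 ![1, 0, 0, 0, 1], ?_, fun h => (h rfl).elim⟩
    rw [gens, hd_mk, tl_mk]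
    simp [gen, qi]
  · refine ⟨mk ![1, 0, 1, 0, 1] ![-2, -1, -2, -2, 2], ?_, fun _ => ?_⟩ <;> rw [gens, hd_mk, tl_mk]
    · fin_cases k <;>
        simp [gen, vd, vq, qi, qj, qgen, sgen, qua, cub, quad, lin, cw, hess, sext, sq] at hk ⊢ <;>
        norm_num
    · simp [gen, qi]; norm_num

/-- The generators satisfy no relation with a linear term. -/
theorem coeff_single_eq_zero {T : MvPolynomial (Fin 18) ℂ} (h : ∀ c, eval (gens c) T = 0)
    (k : Fin 18) : coeff (Finsupp.single k 1) T = 0 := by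
  obtain ⟨c, hc, hc1⟩ := exists_point k
  let T' := weightedHomogeneousComponent degA (degA k)
    (weightedHomogeneousComponent degW (degW k) (weightedHomogeneousComponent degX (degX k) T))
  have h' : eval (gens c) T' = 0 :=
    (eval_gens_component (eval_gens_component (eval_gens_component h _).1 _).2.1 _).2.2 c
  have hcoe : ∀ m, coeff m T' ≠ 0 → Finsupp.weight degX m = degX k ∧
      Finsupp.weight degW m = degW k ∧ Finsupp.weight degA m = degA k := by
    intro m hm
    simp only [T', coeff_weightedHomogeneousComponent] at hm
    split_ifs at hm with h1 h2 h3
    · exact ⟨h3, h2, h1⟩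
    all_goals exact (hm rfl).elim
  have hk : coeff (Finsupp.single k 1) T' = coeff (Finsupp.single k 1) T := by
    simp [T', coeff_weightedHomogeneousComponent, Finsupp.weight_single]
  rw [← hk]
  rw [eval_eq', Finset.sum_eq_single (Finsupp.single k 1)] at h'
  · rw [Finset.prod_eq_single k] at h'
    · simpa [hc] using h'
    · intro j _ hj; simp [hj.symm]
    · simp
  · intro m hm hmk
    obtain ⟨hX, hW, hA⟩ := hcoe m (mem_support_iff.1 hm)
    have : k ≠ 1 ∧ m 1 ≠ 0 := by
      by_contra hcon
      push Not at hcon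
      exact hmk (eq_single_of_weight hX hW hA hcon)
    rw [Finset.prod_eq_zero (Finset.mem_univ 1), mul_zero]
    rw [hc1 this.1, zero_pow this.2]
  · intro hn
    rw [notMem_support_iff.1 hn, zero_mul]

/-- The linear part of a polynomial. -/
def linPart : MvPolynomial (Fin 18) ℂ →ₗ[ℂ] (Fin 18 → ℂ) :=
  LinearMap.pi fun k => lcoeff ℂ (Finsupp.single k 1)

theorem linPart_apply (T : MvPolynomial (Fin 18) ℂ) (k : Fin 18) :
    linPart T k = coeff (Finsupp.single k 1) T := rfl

theorem linPart_mul (S T : MvPolynomial (Fin 18) ℂ) :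
    linPart (S * T) = coeff 0 S • linPart T + coeff 0 T • linPart S := by
  funext k
  have : Finset.HasAntidiagonal.antidiagonal (Finsupp.single k 1 : Fin 18 →₀ ℕ)
      = {(0, Finsupp.single k 1), (Finsupp.single k 1, 0)} := by
    rw [Finsupp.antidiagonal_single, Finset.Nat.antidiagonal_succ]
    simp
  simp only [linPart_apply, Pi.add_apply, Pi.smul_apply, smul_eq_mul, coeff_mul]
  rw [this, Finset.sum_pair (by simp)]
  ring

theorem linPart_X (k : Fin 18) : linPart (X k) = Pi.single k 1 := by
  funext j
  rw [linPart_apply, coeff_X, Pi.single_apply]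
  simp [Finsupp.single_left_inj, eq_comm]

theorem linPart_eq_of_pres_eq {S T : MvPolynomial (Fin 18) ℂ} (h : pres S = pres T) :
    linPart S = linPart T := by
  funext k
  rw [← sub_eq_zero, ← Pi.sub_apply, ← map_sub, linPart_apply]
  refine coeff_single_eq_zero (fun c => ?_) k
  rw [← eval_aeval_gens, ← coe_pres, map_sub, h, sub_self]
  simp

/-- A lift of an invariant to a polynomial in the generators. -/
def presLift (F : ring10) : MvPolynomial (Fin 18) ℂ := (pres_surjective F).choose

theorem pres_lift (F : ring10) : pres (presLift F) = F := (pres_surjective F).choose_spec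

theorem linPart_lift_mem {s : Set ring10} {F : ring10} (hF : F ∈ Algebra.adjoin ℂ s) :
    linPart (presLift F) ∈ Submodule.span ℂ ((fun f => linPart (presLift f)) '' s) := by
  induction hF using Algebra.adjoin_induction with
  | mem x hx => exact Submodule.subset_span ⟨x, hx, rfl⟩
  | algebraMap r =>
    rw [linPart_eq_of_pres_eq (T := C r) ((pres_lift _).trans (pres.commutes r).symm)]
    convert Submodule.zero_mem _ using 1
    funext k
    rw [linPart_apply, coeff_C]
    simp [eq_comm]
  | add x y _ _ hx hy =>
    rw [linPart_eq_of_pres_eq (T := presLift x + presLift y)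
      (by rw [map_add, pres_lift, pres_lift, pres_lift]), map_add]
    exact Submodule.add_mem _ hx hy
  | mul x y _ _ hx hy =>
    rw [linPart_eq_of_pres_eq (T := presLift x * presLift y)
      (by rw [map_mul, pres_lift, pres_lift, pres_lift]), linPart_mul]
    exact Submodule.add_mem _ (Submodule.smul_mem _ _ hy) (Submodule.smul_mem _ _ hx)

theorem card_of_adjoin_eq_top {S : Finset ring10} (hS : Algebra.adjoin ℂ (S : Set ring10) = ⊤) :
    18 ≤ S.card := by
  classical
  have hspan : Submodule.span ℂ (↑(S.image fun f => linPart (presLift f)) : Set (Fin 18 → ℂ)) = ⊤ := by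
    rw [eq_top_iff, ← (Pi.basisFun ℂ (Fin 18)).span_eq, Submodule.span_le]
    rintro _ ⟨k, rfl⟩
    rw [Pi.basisFun_apply, ← linPart_X, ← linPart_eq_of_pres_eq (pres_lift (pres (X k))),
      Finset.coe_image]
    exact linPart_lift_mem (hS ▸ Algebra.mem_top)
  have h := finrank_span_finset_le_card (R := ℂ) (S.image fun f => linPart (presLift f))
  rw [Set.finrank, hspan, finrank_top, Module.finrank_fin_fun] at h
  exact h.trans Finset.card_image_le

theorem pres_X_injective : Function.Injective fun k => pres (X k) := fun j k h => by
  have := linPart_eq_of_pres_eq h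
  rw [linPart_X, linPart_X] at this
  by_contra hjk
  have := congrFun this j
  rw [Pi.single_eq_same, Pi.single_eq_of_ne hjk] at this
  exact one_ne_zero this

theorem adjoin_pres_X : Algebra.adjoin ℂ (Set.range fun k => pres (X k)) = ⊤ := by
  have : (Set.range fun k => pres (X k)) = pres '' Set.range X := (Set.range_comp _ _)
  rw [this, ← AlgHom.map_adjoin, adjoin_range_X, Algebra.map_top, AlgHom.range_eq_top]
  exact pres_surjective

theorem isHomogeneous_pres {S : MvPolynomial (Fin 18) ℂ} {n : ℕ}
    (h : IsWeightedHomogeneous degT S n) : (pres S : MvPolynomial (Fin 10) ℂ).IsHomogeneous n := by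
  have e := component_aeval_gens n S
  rw [h.weightedHomogeneousComponent_same] at e
  rw [coe_pres, ← e]
  exact isWeightedHomogeneous_component _ _ _

/-- The coordinates on `V₁ ⊕ V₂ ⊕ V₄`. -/
abbrev Idx124 : Type := Idx ![1, 2, 4]

/-- The vector, bivector and quartic coordinates, as coefficients of forms. -/
def idxFun : Fin 10 → Idx124 :=
  ![⟨0, (1 : Fin 2)⟩, ⟨0, (0 : Fin 2)⟩, ⟨1, (2 : Fin 3)⟩, ⟨1, (1 : Fin 3)⟩, ⟨1, (0 : Fin 3)⟩,
    ⟨2, (0 : Fin 5)⟩, ⟨2, (1 : Fin 5)⟩, ⟨2, (2 : Fin 5)⟩, ⟨2, (3 : Fin 5)⟩, ⟨2, (4 : Fin 5)⟩]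

theorem idxFun_bijective : Function.Bijective idxFun := by
  constructor <;> decide

/-- `idxFun` as an equivalence. -/
def idxEquiv : Fin 10 ≃ Idx124 := Equiv.ofBijective idxFun idxFun_bijective

/-- The scaling factors between the two systems of coordinates. -/
def scal : Fin 10 → ℂ := ![1, -1, 1, -1 / 2, 1, 1, 1 / 4, 1 / 6, 1 / 4, 1]

theorem scal_ne_zero (i : Fin 10) : scal i ≠ 0 := by
  fin_cases i <;> simp [scal]

/-- The coordinate change on points. -/
def toTen (c : Idx124 → ℂ) : Fin 10 → ℂ := fun i => scal i * c (idxEquiv i)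

theorem toTen_surjective : Function.Surjective toTen := fun d =>
  ⟨fun j => (scal (idxEquiv.symm j))⁻¹ * d (idxEquiv.symm j), funext fun i => by
    rw [toTen, Equiv.symm_apply_apply, mul_inv_cancel_left₀ (scal_ne_zero i)]⟩

theorem coeffAt_formAt {p : ℕ} (n : Fin p → ℕ) (c : Idx n → ℂ) (j : Idx n) :
    coeffAt n j (formAt n c j.1) = c j := by
  have h : ∀ k : Fin (n j.1 + 1), C (c ⟨j.1, k⟩) * X 0 ^ (n j.1 - (k : ℕ)) * X 1 ^ (k : ℕ)
      = monomial (Finsupp.single 0 (n j.1 - (k : ℕ)) + Finsupp.single (1 : Fin 2) (k : ℕ))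
          (c ⟨j.1, k⟩) := fun k => by
    rw [X_pow_eq_monomial, X_pow_eq_monomial, mul_assoc, monomial_mul, C_mul_monomial]
    simp
  rw [coeffAt, formAt, coeff_sum, Finset.sum_eq_single j.2]
  · rw [h, coeff_monomial, if_pos rfl]
  · intro k _ hk
    rw [h, coeff_monomial, if_neg]
    intro he
    have := DFunLike.congr_fun he 1
    simp only [Finsupp.add_apply, Finsupp.single_apply] at this
    exact hk (Fin.ext (by simpa using this))
  · simp

theorem eval_formAt_zero (c : Idx124 → ℂ) (x : Fin 2 → ℂ) : eval x (formAt ![1, 2, 4] c 0)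
    = c ⟨0, (0 : Fin 2)⟩ * x 0 + c ⟨0, (1 : Fin 2)⟩ * x 1 := by
  refine (congrArg (eval x) (Fin.sum_univ_two (fun k : Fin 2 =>
    C (c ⟨0, k⟩) * X 0 ^ (1 - (k : ℕ)) * X 1 ^ (k : ℕ)))).trans ?_
  simp

theorem eval_formAt_one (c : Idx124 → ℂ) (x : Fin 2 → ℂ) : eval x (formAt ![1, 2, 4] c 1)
    = c ⟨1, (0 : Fin 3)⟩ * x 0 ^ 2 + c ⟨1, (1 : Fin 3)⟩ * x 0 * x 1
      + c ⟨1, (2 : Fin 3)⟩ * x 1 ^ 2 := by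
  refine (congrArg (eval x) (Fin.sum_univ_three (fun k : Fin 3 =>
    C (c ⟨1, k⟩) * X 0 ^ (2 - (k : ℕ)) * X 1 ^ (k : ℕ)))).trans ?_
  simp

theorem eval_formAt_two (c : Idx124 → ℂ) (x : Fin 2 → ℂ) : eval x (formAt ![1, 2, 4] c 2)
    = c ⟨2, (0 : Fin 5)⟩ * x 0 ^ 4 + c ⟨2, (1 : Fin 5)⟩ * x 0 ^ 3 * x 1
      + c ⟨2, (2 : Fin 5)⟩ * x 0 ^ 2 * x 1 ^ 2 + c ⟨2, (3 : Fin 5)⟩ * x 0 * x 1 ^ 3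
      + c ⟨2, (4 : Fin 5)⟩ * x 1 ^ 4 := by
  refine (congrArg (eval x) (Fin.sum_univ_five (fun k : Fin 5 =>
    C (c ⟨2, k⟩) * X 0 ^ (4 - (k : ℕ)) * X 1 ^ (k : ℕ)))).trans ?_
  simp

theorem eval_sl2Act (g : Matrix.SpecialLinearGroup (Fin 2) ℂ) (f : MvPolynomial (Fin 2) ℂ)
    (x : Fin 2 → ℂ) : eval x (sl2Act g f)
      = eval ((g⁻¹ : Matrix.SpecialLinearGroup (Fin 2) ℂ).1.mulVec x) f := by
  rw [sl2Act, eval_aeval]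
  refine congrArg (fun y => eval y f) (funext fun i => ?_)
  simp [Matrix.mulVec, dotProduct]

theorem tl_toTen (c : Idx124 → ℂ) : tl (toTen c) = ![1 * c ⟨2, (0 : Fin 5)⟩,
    1 / 4 * c ⟨2, (1 : Fin 5)⟩, 1 / 6 * c ⟨2, (2 : Fin 5)⟩, 1 / 4 * c ⟨2, (3 : Fin 5)⟩,
    1 * c ⟨2, (4 : Fin 5)⟩] := rfl

theorem hd_toTen (c : Idx124 → ℂ) : hd (toTen c) = ![1 * c ⟨0, (1 : Fin 2)⟩,
    -1 * c ⟨0, (0 : Fin 2)⟩, 1 * c ⟨1, (2 : Fin 3)⟩, -1 / 2 * c ⟨1, (1 : Fin 3)⟩,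
    1 * c ⟨1, (0 : Fin 3)⟩] := rfl

theorem sl2Act_formAt (g : Matrix.SpecialLinearGroup (Fin 2) ℂ) {c d : Idx124 → ℂ}
    (h : toTen d = act ((g⁻¹ : Matrix.SpecialLinearGroup (Fin 2) ℂ) 0 0)
      ((g⁻¹ : Matrix.SpecialLinearGroup (Fin 2) ℂ) 0 1)
      ((g⁻¹ : Matrix.SpecialLinearGroup (Fin 2) ℂ) 1 0)
      ((g⁻¹ : Matrix.SpecialLinearGroup (Fin 2) ℂ) 1 1) (toTen c)) (i : Fin 3) :
    sl2Act g (formAt ![1, 2, 4] c i) = formAt ![1, 2, 4] d i := by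
  refine MvPolynomial.funext fun x => ?_
  rw [eval_sl2Act]
  have hx : ∀ i, (g⁻¹ : Matrix.SpecialLinearGroup (Fin 2) ℂ).1.mulVec x i
      = (g⁻¹ : Matrix.SpecialLinearGroup (Fin 2) ℂ) i 0 * x 0
        + (g⁻¹ : Matrix.SpecialLinearGroup (Fin 2) ℂ) i 1 * x 1 := fun i => by
    rw [Matrix.mulVec, dotProduct, Fin.sum_univ_two]
  generalize (g⁻¹ : Matrix.SpecialLinearGroup (Fin 2) ℂ).1.mulVec x = y at hx ⊢
  have hx0 := hx 0
  have hx1 := hx 1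
  clear hx
  generalize (g⁻¹ : Matrix.SpecialLinearGroup (Fin 2) ℂ) 0 0 = p at h hx0
  generalize (g⁻¹ : Matrix.SpecialLinearGroup (Fin 2) ℂ) 0 1 = q at h hx0
  generalize (g⁻¹ : Matrix.SpecialLinearGroup (Fin 2) ℂ) 1 0 = r at h hx1
  generalize (g⁻¹ : Matrix.SpecialLinearGroup (Fin 2) ℂ) 1 1 = s at h hx1
  have hv := congrArg hd h
  have ha := congrArg tl h
  rw [act, hd_mk, hd_toTen, hd_toTen] at hv
  rw [act, tl_mk, tl_toTen, tl_toTen] at ha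
  have e0 := congrFun hv 0
  have e1 := congrFun hv 1
  have e2 := congrFun hv 2
  have e3 := congrFun hv 3
  have e4 := congrFun hv 4
  have e5 := congrFun ha 0
  have e6 := congrFun ha 1
  have e7 := congrFun ha 2
  have e8 := congrFun ha 3
  have e9 := congrFun ha 4
  clear h hv ha
  simp [vact, qact, qua, cub, quad, lin] at e0 e1 e2 e3 e4 e5 e6 e7 e8 e9
  fin_cases i
  · refine (eval_formAt_zero c y).trans (Eq.trans ?_ (eval_formAt_zero d x).symm)
    rw [hx0, hx1]
    linear_combination x 0 * e1 - x 1 * e0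
  · refine (eval_formAt_one c y).trans (Eq.trans ?_ (eval_formAt_one d x).symm)
    rw [hx0, hx1]
    linear_combination -(x 0 ^ 2 * e4) + 2 * x 0 * x 1 * e3 - x 1 ^ 2 * e2
  · refine (eval_formAt_two c y).trans (Eq.trans ?_ (eval_formAt_two d x).symm)
    rw [hx0, hx1]
    linear_combination -(x 0 ^ 4 * e5) - 4 * x 0 ^ 3 * x 1 * e6 - 6 * x 0 ^ 2 * x 1 ^ 2 * e7
      - 4 * x 0 * x 1 ^ 3 * e8 - x 1 ^ 4 * e9

theorem toTen_actPt (g : Matrix.SpecialLinearGroup (Fin 2) ℂ) (c : Idx124 → ℂ) :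
    toTen (actPt ![1, 2, 4] g c) = act ((g⁻¹ : Matrix.SpecialLinearGroup (Fin 2) ℂ) 0 0)
      ((g⁻¹ : Matrix.SpecialLinearGroup (Fin 2) ℂ) 0 1)
      ((g⁻¹ : Matrix.SpecialLinearGroup (Fin 2) ℂ) 1 0)
      ((g⁻¹ : Matrix.SpecialLinearGroup (Fin 2) ℂ) 1 1) (toTen c) := by
  obtain ⟨d, hd⟩ := toTen_surjective (act ((g⁻¹ : Matrix.SpecialLinearGroup (Fin 2) ℂ) 0 0)
      ((g⁻¹ : Matrix.SpecialLinearGroup (Fin 2) ℂ) 0 1)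
      ((g⁻¹ : Matrix.SpecialLinearGroup (Fin 2) ℂ) 1 0)
      ((g⁻¹ : Matrix.SpecialLinearGroup (Fin 2) ℂ) 1 1) (toTen c))
  rw [← hd]
  refine congrArg toTen (funext fun j => ?_)
  rw [actPt, sl2Act_formAt g hd, coeffAt_formAt]

/-- The coordinate change on polynomials. -/
def transport : MvPolynomial (Fin 10) ℂ →ₐ[ℂ] MvPolynomial Idx124 ℂ :=
  aeval fun i => C (scal i) * X (idxEquiv i)

theorem eval_transport (c : Idx124 → ℂ) (F : MvPolynomial (Fin 10) ℂ) :
    eval c (transport F) = eval (toTen c) F := by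
  rw [transport, eval_aeval]
  refine congrArg (fun f => eval f F) (funext fun i => ?_)
  rw [map_mul, eval_C, eval_X, toTen]

theorem transport_injective : Function.Injective transport := fun F G h => by
  refine MvPolynomial.funext fun d => ?_
  obtain ⟨c, rfl⟩ := toTen_surjective d
  rw [← eval_transport, h, eval_transport]

theorem transport_surjective : Function.Surjective transport := by
  rw [← AlgHom.range_eq_top, eq_top_iff, ← adjoin_range_X, Algebra.adjoin_le_iff]
  rintro _ ⟨j, rfl⟩
  refine ⟨C (scal (idxEquiv.symm j))⁻¹ * X (idxEquiv.symm j), ?_⟩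
  refine (map_mul transport _ _).trans ?_
  rw [transport, aeval_X, aeval_C, algebraMap_eq, ← mul_assoc, ← C_mul,
    inv_mul_cancel₀ (scal_ne_zero _), C_1, one_mul, Equiv.apply_symm_apply]

theorem isHomogeneous_transport {F : MvPolynomial (Fin 10) ℂ} {n : ℕ} (h : F.IsHomogeneous n) :
    (transport F).IsHomogeneous n := by
  have := h.aeval (n := 1) (fun i => C (scal i) * X (idxEquiv i)) fun i => by
    simpa using (isHomogeneous_C Idx124 (scal i)).mul (isHomogeneous_X ℂ (idxEquiv i))
  rwa [one_mul] at this

theorem transport_mem_iff (F : MvPolynomial (Fin 10) ℂ) :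
    transport F ∈ invariantRing ![1, 2, 4] ↔ F ∈ ring10 := by
  constructor
  · intro h p q r s hdet c
    obtain ⟨c, rfl⟩ := toTen_surjective c
    let g : Matrix.SpecialLinearGroup (Fin 2) ℂ := ⟨!![p, q; r, s], by rw [Matrix.det_fin_two_of, hdet]⟩
    have := h g⁻¹ c
    rw [eval_transport, eval_transport, toTen_actPt, inv_inv] at this
    exact this
  · intro h g c
    rw [eval_transport, eval_transport, toTen_actPt]
    refine h _ _ _ _ ?_ _
    rw [← Matrix.det_fin_two]
    exact (g⁻¹).2

/-- The ring of invariants, embedded in the polynomial functions on `V₁ ⊕ V₂ ⊕ V₄`. -/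
def embed : ring10 →ₐ[ℂ] MvPolynomial Idx124 ℂ := transport.comp ring10.val

theorem embed_injective : Function.Injective embed :=
  transport_injective.comp Subtype.val_injective

theorem range_embed : embed.range = invariantRing ![1, 2, 4] := by
  ext P
  constructor
  · rintro ⟨F, rfl⟩
    exact (transport_mem_iff F.1).2 F.2
  · intro h
    obtain ⟨F, rfl⟩ := transport_surjective P
    exact ⟨⟨F, (transport_mem_iff F).1 h⟩, rfl⟩

theorem isHomogeneous_embed_pres {S : MvPolynomial (Fin 18) ℂ} {n : ℕ}
    (h : IsWeightedHomogeneous degT S n) : (embed (pres S)).IsHomogeneous n :=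
  isHomogeneous_transport (isHomogeneous_pres h)

theorem isHSOP_embed : IsHSOP ![1, 2, 4] (fun j => embed (pres (prm j))) degP := by
  refine ⟨fun j => ?_, degP_pos, fun j => isHomogeneous_embed_pres (isWeightedHomogeneous_prm j),
    algebraicIndependent_prm.map' embed_injective, fun x hx => ?_⟩
  · rw [← range_embed]; exact ⟨_, rfl⟩
  · rw [← range_embed] at hx
    obtain ⟨F, rfl⟩ := hx
    have := finite_algP
    have hF : IsIntegral algP F := (Algebra.IsIntegral.of_finite algP ring10).isIntegral F
    have hmem : ∀ y : algP, embed y ∈ Algebra.adjoin ℂ (Set.range fun j => embed (pres (prm j))) := by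
      rintro ⟨y, hy⟩
      have : (Set.range fun j => embed (pres (prm j)))
          = embed '' Set.range fun j => pres (prm j) := Set.range_comp _ _
      rw [this, ← AlgHom.map_adjoin]
      exact ⟨y, hy, rfl⟩
    exact IsIntegral.map_of_comp_eq
      (T := Algebra.adjoin ℂ (Set.range fun j => embed (pres (prm j))))
      (U := MvPolynomial Idx124 ℂ)
      ((embed.comp algP.val).codRestrict _ hmem).toRingHom embed.toRingHom rfl hF

theorem range_gens_embed :
    Algebra.adjoin ℂ (Set.range fun k => embed (pres (X k))) = invariantRing ![1, 2, 4] := by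
  have : (Set.range fun k => embed (pres (X k))) = embed '' Set.range fun k => pres (X k) :=
    Set.range_comp _ _
  rw [this, ← AlgHom.map_adjoin, adjoin_pres_X, Algebra.map_top, range_embed]

theorem embed_gens_injective : Function.Injective fun k => embed (pres (X k)) :=
  embed_injective.comp pres_X_injective

theorem hasMinimalGens_embed : HasMinimalGens ![1, 2, 4] degT := by
  classical
  refine ⟨⟨⟨Finset.univ.image fun k => embed (pres (X k)), ?_, ?_⟩, ?_⟩,
    fun k => embed (pres (X k)), embed_gens_injective,
    fun k => isHomogeneous_embed_pres (isWeightedHomogeneous_X ℂ degT k), range_gens_embed⟩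
  · rw [Finset.card_image_of_injective _ embed_gens_injective]; rfl
  · rw [Finset.coe_image, Finset.coe_univ, Set.image_univ, range_gens_embed]
  · rintro _ ⟨S, rfl, hS⟩
    have hsub : (S : Set (MvPolynomial Idx124 ℂ)) ⊆ Set.range embed := fun x hx => by
      have : x ∈ embed.range := by
        rw [range_embed, ← hS]; exact Algebra.subset_adjoin hx
      exact this
    let S' : Finset ring10 := S.preimage embed embed_injective.injOn
    have hS' : embed '' (S' : Set ring10) = S := by
      rw [Finset.coe_preimage, Set.image_preimage_eq_of_subset hsub]
    have hcard : S'.card = S.card := by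
      rw [← Finset.card_image_of_injective S' embed_injective]
      refine congrArg _ (Finset.coe_injective ?_)
      rw [Finset.coe_image, hS']
    rw [← hcard]
    refine card_of_adjoin_eq_top (Subalgebra.map_injective (f := embed) embed_injective ?_)
    rw [AlgHom.map_adjoin, hS', hS, Algebra.map_top, range_embed]

end BinInv

end

open BinInv in
/-- For `V = V₁ ⊕ V₂ ⊕ V₄`: there is a homogeneous system of parameters of degrees
`2, 2, 3, 3, 4, 5, 6`, and the minimal number of generators is `18`, with degrees
`2, 2, 3, 3, 3, 4, 4, 5, 5, 5, 6, 6, 6, 6, 7, 7, 8, 9`. -/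
theorem V1_V2_V4_hsop_and_generators :
    (∃ P : Fin 7 → MvPolynomial (Idx ![1, 2, 4]) ℂ,
      IsHSOP ![1, 2, 4] P ![2, 2, 3, 3, 4, 5, 6]) ∧
    HasMinimalGens ![1, 2, 4]
      ![2, 2, 3, 3, 3, 4, 4, 5, 5, 5, 6, 6, 6, 6, 7, 7, 8, 9] :=
  ⟨⟨_, isHSOP_embed⟩, hasMinimalGens_embed⟩
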